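/- arXiv:1305.4158 — 5 statements merged into one kernel-verified Lean document; each statement's English description precedes it below -/
import Mathlib

section
/- Let S be a relative Schottky set in a domain Ω ⊆ ℂ, and let l : [a,b] → Ω be a continuous curve of finite length with endpoints l(a) = p and l(b) = q, where p, q ∈ S. Then there exists a continuous curve l' : [a,b] → ℂ with image contained in S, with l'(a) = p and l'(b) = q, and with length(l') ≤ π · length(l). -/
open Set Metric MeasureTheory Filter
open scoped NNReal ENNReal Topology

noncomputable section

/-- A (nonempty, open, connected) domain in the complex plane. -/
def IsPlaneDomain (Ω : Set ℂ) : Prop := IsOpen Ω ∧ IsConnected Ω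

/-- A family of open round discs (given by centers `c` and radii `r`) whose closures
are contained in `Ω` and are pairwise disjoint. -/
def IsSchottkyFamily {I : Type*} (Ω : Set ℂ) (c : I → ℂ) (r : I → ℝ) : Prop :=
  (∀ i, 0 < r i) ∧ (∀ i, closedBall (c i) (r i) ⊆ Ω) ∧
    Pairwise fun i j => Disjoint (closedBall (c i) (r i)) (closedBall (c j) (r j))

/-- `S` is a relative Schottky set in the domain `Ω`. -/
def IsRelativeSchottkySet (Ω S : Set ℂ) : Prop :=
  IsPlaneDomain Ω ∧
    ∃ (I : Type) (c : I → ℂ) (r : I → ℝ),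
      IsSchottkyFamily Ω c r ∧ S = Ω \ ⋃ i, ball (c i) (r i)

/-- A Jordan domain: a bounded domain whose boundary is an embedded circle, and which is
a connected component of the complement of its boundary. -/
def IsJordanDomain (Ω : Set ℂ) : Prop :=
  IsPlaneDomain Ω ∧ Bornology.IsBounded Ω ∧
    (∃ γ : ℂ → ℂ, ContinuousOn γ (sphere (0 : ℂ) 1) ∧ InjOn γ (sphere (0 : ℂ) 1) ∧
      γ '' sphere (0 : ℂ) 1 = frontier Ω) ∧
    ∀ p ∈ Ω, connectedComponentIn (frontier Ω)ᶜ p = Ω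

/-- `f : ℂ → ℂ` restricts to a homeomorphism from `S` onto `T`. -/
def IsHomeoOn (f : ℂ → ℂ) (S T : Set ℂ) : Prop :=
  ∃ e : S ≃ₜ T, ∀ z : S, (e z : ℂ) = f (z : ℂ)

/-- `f` is `η`-quasisymmetric on `X`. -/
def QuasisymmetricWith (η : ℝ≥0 ≃ₜ ℝ≥0) (f : ℂ → ℂ) (X : Set ℂ) : Prop :=
  ∀ p ∈ X, ∀ q ∈ X, ∀ s ∈ X, ∀ t : ℝ≥0,
    dist p q ≤ (t : ℝ) * dist p s → dist (f p) (f q) ≤ (η t : ℝ) * dist (f p) (f s)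

/-- `f` is locally quasisymmetric on `X`: its restriction to every compact subset of `X`
is quasisymmetric. -/
def LocallyQuasisymmetricOn (f : ℂ → ℂ) (X : Set ℂ) : Prop :=
  ∀ K ⊆ X, IsCompact K → ∃ η : ℝ≥0 ≃ₜ ℝ≥0, QuasisymmetricWith η f K

/-- `f` is locally bi-Lipschitz on `S`. -/
def LocallyBiLipschitzOn (f : ℂ → ℂ) (S : Set ℂ) : Prop :=
  ∀ p ∈ S, ∃ U ∈ 𝓝[S] p, ∃ L : ℝ, 1 ≤ L ∧
    ∀ x ∈ U, ∀ y ∈ U,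
      dist x y / L ≤ dist (f x) (f y) ∧ dist (f x) (f y) ≤ L * dist x y

/-- Two points of a circle are joined by an arc of that circle, parametrized by a Lipschitz map
whose constant is at most `π / 2` times the length of the chord. -/
theorem exists_arc_of_mem_sphere {c P Q : ℂ} {r : ℝ} (hr : 0 < r)
    (hP : P ∈ sphere c r) (hQ : Q ∈ sphere c r) :
    ∃ γ : ℝ → ℂ, γ 0 = P ∧ γ 1 = Q ∧ (∀ t, γ t ∈ sphere c r) ∧
      ∀ s t, dist (γ s) (γ t) ≤ Real.pi / 2 * dist P Q * |s - t| := by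
  rw [mem_sphere_iff_norm] at hP hQ
  have hP0 : P - c ≠ 0 := norm_pos_iff.1 (hP ▸ hr)
  set w : ℂ := (Q - c) / (P - c) with hw
  have hw1 : ‖w‖ = 1 := by rw [hw, norm_div, hP, hQ, div_self hr.ne']
  have hw0 : w ≠ 0 := by
    rintro h
    simp [h] at hw1
  have hexp : Complex.exp (w.arg * Complex.I) = w := by
    simpa [hw1] using Complex.norm_mul_exp_arg_mul_I w
  have harg : r * |w.arg| ≤ Real.pi / 2 * dist P Q := by
    have h := Complex.angle_le_mul_norm_sub hw1 norm_one
    rw [Complex.angle_one_right hw0] at h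
    have hd : r * ‖w - 1‖ = dist P Q := by
      rw [dist_comm, Complex.dist_eq, ← hP, ← norm_mul, mul_sub, hw, mul_div_cancel₀ _ hP0]
      ring_nf
    calc r * |w.arg| ≤ r * (Real.pi / 2 * ‖w - 1‖) := by gcongr
      _ = Real.pi / 2 * dist P Q := by rw [← hd]; ring
  refine ⟨fun t => c + (P - c) * Complex.exp ((t * w.arg : ℝ) * Complex.I), by simp, ?_, ?_, ?_⟩
  · simp only [one_mul, hexp]
    rw [hw, mul_div_cancel₀ _ hP0]
    ring
  · intro t
    rw [mem_sphere_iff_norm, add_sub_cancel_left, norm_mul, Complex.norm_exp_ofReal_mul_I, hP,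
      mul_one]
  · intro s t
    have hfac : Complex.exp ((s * w.arg : ℝ) * Complex.I) - Complex.exp ((t * w.arg : ℝ) * Complex.I)
        = Complex.exp ((t * w.arg : ℝ) * Complex.I) *
          (Complex.exp (Complex.I * ((s - t) * w.arg : ℝ)) - 1) := by
      rw [mul_sub, ← Complex.exp_add, mul_one]
      congr 2
      push_cast
      ring
    rw [Complex.dist_eq, add_sub_add_left_eq_sub, ← mul_sub, norm_mul, hfac, norm_mul,
      Complex.norm_exp_ofReal_mul_I, one_mul, hP]
    calc r * ‖Complex.exp (Complex.I * ((s - t) * w.arg : ℝ)) - 1‖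
        ≤ r * ‖(s - t) * w.arg‖ := by
          gcongr
          exact Real.norm_exp_I_mul_ofReal_sub_one_le
      _ = (r * |w.arg|) * |s - t| := by rw [norm_mul, Real.norm_eq_abs, Real.norm_eq_abs]; ring
      _ ≤ Real.pi / 2 * dist P Q * |s - t| := by gcongr

/-- A function on a closed set `K` of reals that is controlled by a monotone function `V` extends
across the gaps of `K`, with the same control up to a factor `C`, provided that it does so across
each gap separately. -/
theorem exists_extension_across_gaps {E : Type*} [PseudoMetricSpace E] {a b C : ℝ} {K : Set ℝ}
    {S : Set E} {l : ℝ → E} {V : ℝ → ℝ} (hC : 1 ≤ C) (hK : IsClosed K) (hKab : K ⊆ Icc a b)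
    (ha : a ∈ K) (hb : b ∈ K)
    (hl : ∀ x ∈ K, ∀ y ∈ K, x ≤ y → dist (l x) (l y) ≤ V y - V x)
    (hgap : ∀ s ∈ K, ∀ t ∈ K, s ≤ t → Disjoint (Ioo s t) K →
      ∃ g : ℝ → E, g s = l s ∧ g t = l t ∧ MapsTo g (Icc s t) S ∧
        ∀ x ∈ Icc s t, ∀ y ∈ Icc s t, x ≤ y → dist (g x) (g y) ≤ C * (V y - V x)) :
    ∃ l' : ℝ → E, EqOn l' l K ∧ MapsTo l' (Icc a b) S ∧
      ∀ x ∈ Icc a b, ∀ y ∈ Icc a b, x ≤ y → dist (l' x) (l' y) ≤ C * (V y - V x) := by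
  have hlow : ∀ y ∈ Icc a b, ∃ s, IsGreatest (K ∩ Icc a y) s := fun y hy =>
    (isCompact_Icc.inter_left hK).exists_isGreatest ⟨a, ha, le_rfl, hy.1⟩
  have hupp : ∀ y ∈ Icc a b, ∃ t, IsLeast (K ∩ Icc y b) t := fun y hy =>
    (isCompact_Icc.inter_left hK).exists_isLeast ⟨b, hb, hy.2, le_rfl⟩
  choose! σ hσ using hlow
  choose! τ hτ using hupp
  have : Nonempty E := ⟨l a⟩
  choose! G hGs hGt hGS hGV using hgap
  have hσK : ∀ y ∈ Icc a b, σ y ∈ K := fun y hy => (hσ y hy).1.1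
  have hτK : ∀ y ∈ Icc a b, τ y ∈ K := fun y hy => (hτ y hy).1.1
  have hσle : ∀ y ∈ Icc a b, σ y ≤ y := fun y hy => (hσ y hy).1.2.2
  have hleτ : ∀ y ∈ Icc a b, y ≤ τ y := fun y hy => (hτ y hy).1.2.1
  have hσmax : ∀ y ∈ Icc a b, ∀ k ∈ K, k ≤ y → k ≤ σ y := fun y hy k hk hky =>
    (hσ y hy).2 ⟨hk, (hKab hk).1, hky⟩
  have hτmin : ∀ y ∈ Icc a b, ∀ k ∈ K, y ≤ k → τ y ≤ k := fun y hy k hk hky =>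
    (hτ y hy).2 ⟨hk, hky, (hKab hk).2⟩
  have hle : ∀ y ∈ Icc a b, σ y ≤ τ y := fun y hy => (hσle y hy).trans (hleτ y hy)
  have hdisj : ∀ y ∈ Icc a b, Disjoint (Ioo (σ y) (τ y)) K := by
    intro y hy
    rw [Set.disjoint_left]
    intro k hk hkK
    rcases le_total k y with h | h
    · exact absurd (hσmax y hy k hkK h) (not_le.2 hk.1)
    · exact absurd (hτmin y hy k hkK h) (not_le.2 hk.2)
  have hmem : ∀ y ∈ Icc a b, y ∈ Icc (σ y) (τ y) := fun y hy => ⟨hσle y hy, hleτ y hy⟩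
  refine ⟨fun y => G (σ y) (τ y) y, ?_, ?_, ?_⟩
  · intro k hk
    have hkI := hKab hk
    have h1 : σ k = k := le_antisymm (hσle k hkI) (hσmax k hkI k hk le_rfl)
    have h2 : τ k = k := le_antisymm (hτmin k hkI k hk le_rfl) (hleτ k hkI)
    simp only [h1, h2]
    exact hGs k hk k hk le_rfl (by simp)
  · intro y hy
    exact hGS _ (hσK y hy) _ (hτK y hy) (hle y hy) (hdisj y hy) (hmem y hy)
  · intro x hx y hy hxy
    have gx := hGV _ (hσK x hx) _ (hτK x hx) (hle x hx) (hdisj x hx)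
    have gy := hGV _ (hσK y hy) _ (hτK y hy) (hle y hy) (hdisj y hy)
    have ex := hGt _ (hσK x hx) _ (hτK x hx) (hle x hx) (hdisj x hx)
    have ey := hGs _ (hσK y hy) _ (hτK y hy) (hle y hy) (hdisj y hy)
    rcases le_or_gt (τ x) y with h | h
    · have hts : τ x ≤ σ y := hσmax y hy _ (hτK x hx) h
      have d1 := gx x (hmem x hx) (τ x) (right_mem_Icc.2 (hle x hx)) (hleτ x hx)
      have d3 := gy (σ y) (left_mem_Icc.2 (hle y hy)) y (hmem y hy) (hσle y hy)
      have d2 := hl _ (hτK x hx) _ (hσK y hy) hts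
      have hpos : 0 ≤ V (σ y) - V (τ x) := dist_nonneg.trans d2
      rw [ex] at d1
      rw [ey] at d3
      have := dist_triangle4 (G (σ x) (τ x) x) (l (τ x)) (l (σ y)) (G (σ y) (τ y) y)
      simp only
      nlinarith
    · have h1 : σ y = σ x := by
        refine le_antisymm ?_ (hσmax y hy _ (hσK x hx) ((hσle x hx).trans hxy))
        refine hσmax x hx _ (hσK y hy) (le_of_not_gt fun hlt => ?_)
        exact absurd ((hτmin x hx _ (hσK y hy) hlt.le).trans (hσle y hy)) (not_le.2 h)
      have h2 : τ y = τ x :=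
        le_antisymm (hτmin y hy _ (hτK x hx) h.le)
          (hτmin x hx _ (hτK y hy) (hxy.trans (hleτ y hy)))
      simp only [h1, h2]
      exact gx x (hmem x hx) y ⟨(hσle x hx).trans hxy, h.le⟩ hxy

/-- A curve controlled by a continuous function of its parameter is continuous. -/
theorem continuousOn_of_dist_le_mul_sub {E : Type*} [PseudoMetricSpace E] {C : ℝ} {s : Set ℝ}
    {f : ℝ → E} {V : ℝ → ℝ} (hV : ContinuousOn V s)
    (h : ∀ x ∈ s, ∀ y ∈ s, x ≤ y → dist (f x) (f y) ≤ C * (V y - V x)) :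
    ContinuousOn f s := by
  intro x hx
  have hlim : Tendsto (fun y => |C * (V y - V x)|) (𝓝[s] x) (𝓝 0) := by
    simpa using (((hV x hx).sub_const (V x)).const_mul C).abs
  refine tendsto_iff_dist_tendsto_zero.2 (squeeze_zero' (Eventually.of_forall fun _ => dist_nonneg)
    ?_ hlim)
  filter_upwards [self_mem_nhdsWithin] with y hy
  rcases le_total x y with hxy | hxy
  · rw [dist_comm]
    exact (h x hx y hy hxy).trans (le_abs_self _)
  · refine (h y hy x hx hxy).trans ?_
    rw [← abs_neg, ← mul_neg, neg_sub]
    exact le_abs_self _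

/-- A curve controlled by a multiple of a monotone function has variation at most that multiple of
the increment of the function. -/
theorem eVariationOn_le_of_dist_le_mul_sub {E : Type*} [PseudoMetricSpace E] {a b C : ℝ}
    {f : ℝ → E} {V : ℝ → ℝ} (hab : a ≤ b) (hC : 0 ≤ C) (hV : MonotoneOn V (Icc a b))
    (h : ∀ x ∈ Icc a b, ∀ y ∈ Icc a b, x ≤ y → dist (f x) (f y) ≤ C * (V y - V x)) :
    eVariationOn f (Icc a b) ≤ ENNReal.ofReal C * ENNReal.ofReal (V b - V a) := by
  have hVar := hV.eVariationOn_eq (left_mem_Icc.2 hab) (right_mem_Icc.2 hab)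
  rw [inter_self] at hVar
  rw [← hVar]
  refine iSup_le fun ⟨n, u, hu, hus⟩ => ?_
  refine le_trans ?_ (mul_le_mul_right (eVariationOn.sum_le (n := n) hu hus) _)
  rw [Finset.mul_sum]
  refine Finset.sum_le_sum fun i _ => ?_
  rw [edist_comm, edist_dist, edist_dist, ← ENNReal.ofReal_mul hC]
  refine ENNReal.ofReal_le_ofReal ((h _ (hus i) _ (hus (i + 1)) (hu i.le_succ)).trans ?_)
  rw [Real.dist_eq]
  gcongr
  exact le_abs_self _

/-- The variation function of a continuous function of bounded variation is continuous. -/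
theorem ContinuousOn.variationOnFromTo {E : Type*} [PseudoEMetricSpace E] {s : Set ℝ} {f : ℝ → E}
    (hf : ContinuousOn f s) (hbv : BoundedVariationOn f s) {a : ℝ} (ha : a ∈ s) :
    ContinuousOn (variationOnFromTo f s a) s := by
  intro x hx
  have hright := hbv.tendsto_eVariationOn_Icc_zero_right x ((hf x hx).mono inter_subset_left)
  have hleft := hbv.tendsto_eVariationOn_Icc_zero_left ((hf x hx).mono inter_subset_left)
  have hlim : Tendsto (_root_.variationOnFromTo f s x) (𝓝[s] x) (𝓝 0) := by
    have h := ((ENNReal.tendsto_toReal ENNReal.zero_ne_top).comp hright).sub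
      ((ENNReal.tendsto_toReal ENNReal.zero_ne_top).comp hleft)
    rw [ENNReal.toReal_zero, sub_zero] at h
    refine h.congr fun y => ?_
    rcases le_total x y with hxy | hxy
    · rw [variationOnFromTo.eq_of_le _ _ hxy]
      have : (s ∩ Icc y x).Subsingleton := by grind [Set.Subsingleton]
      simp [eVariationOn.subsingleton f this]
    · rw [variationOnFromTo.eq_of_ge _ _ hxy]
      have : (s ∩ Icc x y).Subsingleton := by grind [Set.Subsingleton]
      simp [eVariationOn.subsingleton f this]
  have h := hlim.const_add (_root_.variationOnFromTo f s a x)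
  rw [add_zero] at h
  refine h.congr' ?_
  filter_upwards [self_mem_nhdsWithin] with y hy
  exact variationOnFromTo.add hbv.locallyBoundedVariationOn ha hx hy

/-- If a curve runs in a disjoint union of open discs between two parameters at which it lies
outside of all of them, then its endpoints lie on the boundary circle of a single disc. -/
theorem exists_mem_sphere_of_mapsTo_iUnion_ball {I : Type*} {c : I → ℂ} {r : I → ℝ}
    (hdisj : Pairwise fun i j => Disjoint (ball (c i) (r i)) (ball (c j) (r j)))
    {l : ℝ → ℂ} {s t : ℝ} (hst : s < t) (hl : ContinuousOn l (Icc s t))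
    (hmaps : MapsTo l (Ioo s t) (⋃ i, ball (c i) (r i)))
    (hs : l s ∉ ⋃ i, ball (c i) (r i)) (ht : l t ∉ ⋃ i, ball (c i) (r i)) :
    ∃ i, l s ∈ sphere (c i) (r i) ∧ l t ∈ sphere (c i) (r i) := by
  obtain ⟨m, hm⟩ := nonempty_Ioo.2 hst
  obtain ⟨i, hi⟩ := mem_iUnion.1 (hmaps hm)
  have hpre : IsPreconnected (l '' Ioo s t) :=
    isPreconnected_Ioo.image l (hl.mono Ioo_subset_Icc_self)
  have hsub : l '' Ioo s t ⊆ ball (c i) (r i) := by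
    refine hpre.subset_left_of_subset_union (v := ⋃ j ∈ {j | j ≠ i}, ball (c j) (r j)) isOpen_ball
      (isOpen_biUnion fun _ _ => isOpen_ball) ?_ ?_ ⟨l m, ⟨m, hm, rfl⟩, hi⟩
    · exact disjoint_iUnion₂_right.2 fun j hj => hdisj (Ne.symm hj)
    · rintro _ ⟨x, hx, rfl⟩
      obtain ⟨j, hj⟩ := mem_iUnion.1 (hmaps hx)
      by_cases hji : j = i
      · exact Or.inl (hji ▸ hj)
      · exact Or.inr (mem_iUnion₂.2 ⟨j, hji, hj⟩)
  have hcl : MapsTo l (Icc s t) (closedBall (c i) (r i)) := by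
    rw [← closure_Ioo hst.ne] at hl ⊢
    exact fun x hx => closure_ball_subset_closedBall
      (closure_mono hsub (hl.image_closure ⟨x, hx, rfl⟩))
  have key : ∀ x ∈ Icc s t, l x ∉ ⋃ i, ball (c i) (r i) → l x ∈ sphere (c i) (r i) :=
    fun x hx hxn => le_antisymm (hcl hx) (not_lt.1 fun h => hxn (mem_iUnion.2 ⟨i, h⟩))
  exact ⟨i, key s (left_mem_Icc.2 hst.le) hs, key t (right_mem_Icc.2 hst.le) ht⟩

/-- Any rectifiable curve in `Ω` with endpoints in a relative Schottky set
`S ⊆ Ω` can be replaced by a curve in `S` with the same endpoints whose length is at most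
`π` times the length of the original curve. -/
theorem schottky_curve_replacement
    (Ω S : Set ℂ) (hS : IsRelativeSchottkySet Ω S)
    (a b : ℝ) (hab : a ≤ b) (l : ℝ → ℂ)
    (hlc : ContinuousOn l (Icc a b)) (hlΩ : MapsTo l (Icc a b) Ω)
    (hfin : eVariationOn l (Icc a b) ≠ ⊤)
    (hp : l a ∈ S) (hq : l b ∈ S) :
    ∃ l' : ℝ → ℂ, ContinuousOn l' (Icc a b) ∧ MapsTo l' (Icc a b) S ∧
      l' a = l a ∧ l' b = l b ∧
      eVariationOn l' (Icc a b) ≤ ENNReal.ofReal Real.pi * eVariationOn l (Icc a b) := by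
  obtain ⟨-, I, c, r, ⟨hr, hcΩ, hdisj⟩, rfl⟩ := hS
  set U : Set ℂ := ⋃ i, ball (c i) (r i) with hU
  have hUo : IsOpen U := isOpen_iUnion fun _ => isOpen_ball
  have hballs : Pairwise fun i j => Disjoint (ball (c i) (r i)) (ball (c j) (r j)) :=
    fun i j hij => (hdisj hij).mono ball_subset_closedBall ball_subset_closedBall
  have hsphere : ∀ i, sphere (c i) (r i) ⊆ Ω \ U := by
    intro i z hz
    refine ⟨hcΩ i (sphere_subset_closedBall hz), fun hzU => ?_⟩
    obtain ⟨j, hj⟩ := mem_iUnion.1 hzU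
    by_cases hij : i = j
    · subst hij
      exact (mem_ball.1 hj).ne (mem_sphere.1 hz)
    · exact disjoint_left.1 (hdisj hij) (sphere_subset_closedBall hz) (ball_subset_closedBall hj)
  have haI : a ∈ Icc a b := left_mem_Icc.2 hab
  have hbI : b ∈ Icc a b := right_mem_Icc.2 hab
  have hbv : BoundedVariationOn l (Icc a b) := hfin
  have hlbv := hbv.locallyBoundedVariationOn
  set V : ℝ → ℝ := variationOnFromTo l (Icc a b) a with hV
  have hVmono : MonotoneOn V (Icc a b) := variationOnFromTo.monotoneOn hlbv haI
  have hVcont : ContinuousOn V (Icc a b) := hlc.variationOnFromTo hbv haI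
  have hlV : ∀ x ∈ Icc a b, ∀ y ∈ Icc a b, x ≤ y → dist (l x) (l y) ≤ V y - V x := by
    intro x hx y hy hxy
    rw [hV, variationOnFromTo.sub_right hlbv haI hy hx, variationOnFromTo.eq_of_le _ _ hxy]
    exact BoundedVariationOn.dist_le (hlbv x y hx hy) ⟨hx, le_rfl, hxy⟩ ⟨hy, hxy, le_rfl⟩
  have hpi : 1 ≤ Real.pi / 2 := by linarith [Real.two_le_pi]
  have hKab : Icc a b ∩ l ⁻¹' Uᶜ ⊆ Icc a b := inter_subset_left
  have hgap : ∀ s ∈ Icc a b ∩ l ⁻¹' Uᶜ, ∀ t ∈ Icc a b ∩ l ⁻¹' Uᶜ, s ≤ t →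
      Disjoint (Ioo s t) (Icc a b ∩ l ⁻¹' Uᶜ) →
      ∃ g : ℝ → ℂ, g s = l s ∧ g t = l t ∧ MapsTo g (Icc s t) (Ω \ U) ∧
        ∀ x ∈ Icc s t, ∀ y ∈ Icc s t, x ≤ y →
          dist (g x) (g y) ≤ Real.pi / 2 * (V y - V x) := by
    rintro s ⟨hsI, hsU⟩ t ⟨htI, htU⟩ hst hgap
    have hVst : ∀ x ∈ Icc s t, ∀ y ∈ Icc s t, x ≤ y → 0 ≤ V y - V x := fun x hx y hy hxy =>
      sub_nonneg.2 (hVmono (Icc_subset_Icc hsI.1 htI.2 hx) (Icc_subset_Icc hsI.1 htI.2 hy) hxy)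
    rcases (hVmono hsI htI hst).eq_or_lt with hVeq | hVlt
    · have hleq : l s = l t := by
        have := hlV s hsI t htI hst
        rw [hVeq, sub_self] at this
        exact dist_le_zero.1 this
      refine ⟨fun _ => l s, rfl, hleq, fun _ _ => ⟨hlΩ hsI, hsU⟩, fun x hx y hy hxy => ?_⟩
      rw [dist_self]
      exact mul_nonneg (by positivity) (hVst x hx y hy hxy)
    · have hlt : s < t := hst.lt_of_ne (by rintro rfl; exact lt_irrefl _ hVlt)
      have hsub : Icc s t ⊆ Icc a b := Icc_subset_Icc hsI.1 htI.2
      obtain ⟨i, hsi, hti⟩ := exists_mem_sphere_of_mapsTo_iUnion_ball hballs hlt (hlc.mono hsub)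
        (fun x hx => by_contra fun hxU =>
          disjoint_left.1 hgap hx ⟨hsub (Ioo_subset_Icc_self hx), hxU⟩) hsU htU
      obtain ⟨γ, hγ0, hγ1, hγS, hγL⟩ := exists_arc_of_mem_sphere (hr i) hsi hti
      have hpos : 0 < V t - V s := sub_pos.2 hVlt
      refine ⟨fun x => γ ((V x - V s) / (V t - V s)), ?_, ?_, fun x _ => hsphere i (hγS _), ?_⟩
      · simpa using hγ0
      · simpa [div_self hpos.ne'] using hγ1
      · intro x hx y hy hxy
        have hxy' := hVst x hx y hy hxy
        refine (hγL _ _).trans ?_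
        rw [← sub_div, sub_sub_sub_cancel_right, abs_div, abs_of_pos hpos, abs_sub_comm,
          abs_of_nonneg hxy', mul_assoc]
        gcongr
        calc dist (l s) (l t) * ((V y - V x) / (V t - V s))
            ≤ (V t - V s) * ((V y - V x) / (V t - V s)) := by
              gcongr
              exact hlV s hsI t htI hst
          _ = V y - V x := mul_div_cancel₀ _ hpos.ne'
  obtain ⟨l', hl'K, hl'S, hl'V⟩ := exists_extension_across_gaps (S := Ω \ U) (l := l) (V := V) hpi
    (hlc.preimage_isClosed_of_isClosed isClosed_Icc hUo.isClosed_compl) hKab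
    ⟨haI, hp.2⟩ ⟨hbI, hq.2⟩ (fun x hx y hy => hlV x (hKab hx) y (hKab hy)) hgap
  refine ⟨l', continuousOn_of_dist_le_mul_sub hVcont hl'V, hl'S, hl'K ⟨haI, hp.2⟩,
    hl'K ⟨hbI, hq.2⟩, ?_⟩
  refine (eVariationOn_le_of_dist_le_mul_sub hab (by positivity) hVmono hl'V).trans ?_
  rw [hV, variationOnFromTo.self, sub_zero, variationOnFromTo.eq_of_le _ _ hab, inter_self,
    ENNReal.ofReal_toReal hfin]
  gcongr
  linarith [Real.pi_pos]
end
end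

section
/- Every relative Schottky set in a domain Ω ⊆ ℂ is path-connected. -/
open Set Metric MeasureTheory Filter
open scoped NNReal ENNReal Topology

noncomputable section

/-- Removing a countable set from an open ball of dimension at least two leaves a path-connected
set. -/
theorem isPathConnected_ball_diff_countable {E : Type*} [NormedAddCommGroup E]
    [InnerProductSpace ℝ E] (h : 1 < Module.rank ℝ E) {C : Set E} (hC : C.Countable) (a : E)
    {ρ : ℝ} (hρ : 0 < ρ) : IsPathConnected (ball a ρ \ C) := by
  set e := OpenPartialHomeomorph.univBall (E := E) a ρ
  have hinj : InjOn e univ := by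
    simpa [e] using e.injOn
  have hpre : (e ⁻¹' C).Countable :=
    hC.preimage_of_injOn (hinj.mono (subset_univ _))
  have himage : e '' (e ⁻¹' C)ᶜ = ball a ρ \ C := by
    have hrange : range e = ball a ρ := by
      rw [← image_univ, ← OpenPartialHomeomorph.univBall_target a hρ, ← e.image_source_eq_target,
        OpenPartialHomeomorph.univBall_source]
    rw [← preimage_compl, image_preimage_eq_inter_range, hrange, inter_comm, sdiff_eq]
  rw [← himage]
  exact (hpre.isPathConnected_compl_of_one_lt_rank h).image
    (OpenPartialHomeomorph.continuous_univBall a ρ)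

/-- Removing a countable set from a connected open set of dimension at least two leaves a
path-connected set. -/
theorem IsOpen.isPathConnected_diff_countable {E : Type*} [NormedAddCommGroup E]
    [InnerProductSpace ℝ E] (h : 1 < Module.rank ℝ E) {U C : Set E} (hU : IsOpen U)
    (hU' : IsConnected U) (hC : C.Countable) : IsPathConnected (U \ C) := by
  have : Nontrivial E := (rank_pos_iff_nontrivial (R := ℝ)).1 (zero_lt_one.trans h)
  have hdense : Dense Cᶜ := hC.dense_compl ℝ
  refine isPathConnected_iff.2 ⟨hdense.inter_open_nonempty U hU hU'.nonempty, ?_⟩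
  rintro x ⟨hxU, hxC⟩ y ⟨hyU, hyC⟩
  let P : E → E → Prop := fun a b ↦
    ∀ᶠ x in 𝓝 a, ∀ᶠ y in 𝓝 b, x ∉ C → y ∉ C → JoinedIn (U \ C) x y
  have hP : P x y := by
    refine hU'.isPreconnected.induction₂' P (fun a ha ↦ ?_) ?_ hxU hyU
    · obtain ⟨ρ, hρ, hball⟩ := Metric.isOpen_iff.1 hU a ha
      have key : ∀ u ∈ ball a ρ, ∀ v ∈ ball a ρ, P u v := by
        intro u hu v hv
        filter_upwards [isOpen_ball.mem_nhds hu] with u' hu'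
        filter_upwards [isOpen_ball.mem_nhds hv] with v' hv' hu'C hv'C
        exact ((isPathConnected_ball_diff_countable h hC a hρ).joinedIn u' ⟨hu', hu'C⟩ v'
          ⟨hv', hv'C⟩).mono (sdiff_subset_sdiff_left hball)
      filter_upwards [nhdsWithin_le_nhds (ball_mem_nhds a hρ)] with b hb
      exact ⟨key a (mem_ball_self hρ) b hb, key b hb a (mem_ball_self hρ)⟩
    · intro a b c _ _ _ hab hbc
      filter_upwards [hab] with u hu
      obtain ⟨v, hvC, huv, hvc⟩ :=
        ((mem_closure_iff_frequently.1 (hdense b)).and_eventually (hu.and hbc)).exists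
      filter_upwards [hvc] with w hw huC hwC
      exact (huv huC hvC).trans (hw hvC hwC)
  exact hP.self_of_nhds.self_of_nhds hxC hyC

section RadialProjection

variable {E : Type*} [NormedAddCommGroup E] [NormedSpace ℝ E]

/-- Radial projection from `a` to the sphere of radius `ρ` centred at `a`. -/
def radialProj (a : E) (ρ : ℝ) (z : E) : E := a + (ρ / ‖z - a‖) • (z - a)

theorem continuousAt_radialProj {a : E} (ρ : ℝ) {z : E} (hz : z ≠ a) :
    ContinuousAt (radialProj a ρ) z := by
  have : ‖z - a‖ ≠ 0 := norm_ne_zero_iff.2 (sub_ne_zero.2 hz)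
  unfold radialProj
  fun_prop (disch := assumption)

theorem radialProj_mem_sphere {a : E} {ρ : ℝ} (hρ : 0 ≤ ρ) {z : E} (hz : z ≠ a) :
    radialProj a ρ z ∈ sphere a ρ := by
  have : ‖z - a‖ ≠ 0 := norm_ne_zero_iff.2 (sub_ne_zero.2 hz)
  rw [mem_sphere_iff_norm, radialProj, add_sub_cancel_left, norm_smul, Real.norm_eq_abs,
    abs_of_nonneg (by positivity)]
  field_simp

/-- Radial projection moves a point of the punctured ball by at most its distance to any point
outside the ball. -/
theorem dist_radialProj_le {a : E} {ρ : ℝ} {z w : E} (hz : z ≠ a) (hzρ : z ∈ ball a ρ)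
    (hw : w ∉ ball a ρ) : dist (radialProj a ρ z) z ≤ dist z w := by
  have hpos : 0 < ‖z - a‖ := norm_pos_iff.2 (sub_ne_zero.2 hz)
  rw [mem_ball, dist_eq_norm] at hzρ
  rw [mem_ball, not_lt] at hw
  have heq : radialProj a ρ z - z = (ρ / ‖z - a‖ - 1) • (z - a) := by
    rw [radialProj, sub_smul, one_smul]
    abel
  have hnonneg : 0 ≤ ρ / ‖z - a‖ - 1 := by
    rw [sub_nonneg, le_div_iff₀ hpos]
    linarith
  have hdist : dist (radialProj a ρ z) z = ρ - ‖z - a‖ := by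
    rw [dist_eq_norm, heq, norm_smul, Real.norm_eq_abs, abs_of_nonneg hnonneg]
    field_simp
  have := dist_triangle w z a
  rw [dist_comm w z, dist_eq_norm z a] at this
  linarith

open Classical in
/-- The map that projects each ball `ball (c i) (r i)` radially to its bounding sphere and fixes
all points outside these balls. -/
def ballsProj {I : Type*} (c : I → E) (r : I → ℝ) (z : E) : E :=
  if h : ∃ i, z ∈ ball (c i) (r i) then radialProj (c h.choose) (r h.choose) z else z

variable {I : Type*} {c : I → E} {r : I → ℝ}

theorem ballsProj_of_mem
    (hd : Pairwise fun i j => Disjoint (closedBall (c i) (r i)) (closedBall (c j) (r j)))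
    {i : I} {z : E} (hz : z ∈ ball (c i) (r i)) :
    ballsProj c r z = radialProj (c i) (r i) z := by
  have h : ∃ i, z ∈ ball (c i) (r i) := ⟨i, hz⟩
  have hi : h.choose = i := by
    by_contra hne
    exact disjoint_left.1 (hd hne) (ball_subset_closedBall h.choose_spec)
      (ball_subset_closedBall hz)
  rw [ballsProj, dif_pos h, hi]

theorem ballsProj_of_notMem {z : E} (hz : z ∉ ⋃ i, ball (c i) (r i)) : ballsProj c r z = z :=
  dif_neg (by simpa only [mem_iUnion] using hz)

theorem continuousOn_ballsProj
    (hd : Pairwise fun i j => Disjoint (closedBall (c i) (r i)) (closedBall (c j) (r j))) :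
    ContinuousOn (ballsProj c r) (range c)ᶜ := by
  intro z hz
  by_cases hzB : z ∈ ⋃ i, ball (c i) (r i)
  · obtain ⟨i, hi⟩ := mem_iUnion.1 hzB
    have hzc : z ≠ c i := fun h ↦ hz ⟨i, h.symm⟩
    refine ((continuousAt_radialProj (r i) hzc).congr ?_).continuousWithinAt
    filter_upwards [isOpen_ball.mem_nhds hi] with w hw
    exact (ballsProj_of_mem hd hw).symm
  · rw [Metric.continuousWithinAt_iff]
    refine fun ε hε ↦ ⟨ε / 2, half_pos hε, fun w hw hwz ↦ ?_⟩
    rw [ballsProj_of_notMem hzB]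
    have hmove : dist (ballsProj c r w) w ≤ dist w z := by
      by_cases hwB : w ∈ ⋃ i, ball (c i) (r i)
      · obtain ⟨i, hi⟩ := mem_iUnion.1 hwB
        rw [ballsProj_of_mem hd hi]
        exact dist_radialProj_le (fun h ↦ hw ⟨i, h.symm⟩) hi fun h ↦ hzB (mem_iUnion.2 ⟨i, h⟩)
      · rw [ballsProj_of_notMem hwB, dist_self]
        exact dist_nonneg
    linarith [dist_triangle (ballsProj c r w) w z]

theorem image_ballsProj (hr : ∀ i, 0 < r i) {U : Set E}
    (hU : ∀ i, closedBall (c i) (r i) ⊆ U)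
    (hd : Pairwise fun i j => Disjoint (closedBall (c i) (r i)) (closedBall (c j) (r j))) :
    ballsProj c r '' (U \ range c) = U \ ⋃ i, ball (c i) (r i) := by
  apply Subset.antisymm
  · rintro _ ⟨z, ⟨hzU, hzc⟩, rfl⟩
    by_cases hzB : z ∈ ⋃ i, ball (c i) (r i)
    · obtain ⟨i, hi⟩ := mem_iUnion.1 hzB
      have hs := radialProj_mem_sphere (hr i).le (fun h : z = c i ↦ hzc ⟨i, h.symm⟩)
      rw [ballsProj_of_mem hd hi]
      refine ⟨hU i (sphere_subset_closedBall hs), fun hB ↦ ?_⟩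
      obtain ⟨j, hj⟩ := mem_iUnion.1 hB
      obtain rfl | hne := eq_or_ne i j
      · exact (mem_ball.1 hj).ne (mem_sphere.1 hs)
      · exact disjoint_left.1 (hd hne) (sphere_subset_closedBall hs) (ball_subset_closedBall hj)
    · rw [ballsProj_of_notMem hzB]
      exact ⟨hzU, hzB⟩
  · rintro z ⟨hzU, hzB⟩
    refine ⟨z, ⟨hzU, ?_⟩, ballsProj_of_notMem hzB⟩
    rintro ⟨i, rfl⟩
    exact hzB (mem_iUnion.2 ⟨i, mem_ball_self (hr i)⟩)

end RadialProjection

/-- Every relative Schottky set in a domain `Ω ⊆ ℂ` is path-connected. -/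
theorem schottky_isPathConnected
    (Ω S : Set ℂ) (hS : IsRelativeSchottkySet Ω S) :
    IsPathConnected S := by
  obtain ⟨⟨hopen, hconn⟩, I, c, r, ⟨hr, hsub, hd⟩, rfl⟩ := hS
  have : Countable I :=
    Pairwise.countable_of_isOpen_disjoint (s := fun i ↦ ball (c i) (r i))
      (fun _ _ hij ↦ (hd hij).mono ball_subset_closedBall ball_subset_closedBall)
      (fun _ ↦ isOpen_ball) (fun i ↦ nonempty_ball.2 (hr i))
  have hrank : 1 < Module.rank ℝ ℂ := by
    rw [Complex.rank_real_complex]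
    exact Nat.one_lt_ofNat
  rw [← image_ballsProj hr hsub hd]
  exact (hopen.isPathConnected_diff_countable hrank hconn (countable_range c)).image'
    ((continuousOn_ballsProj hd).mono fun _ hz ↦ hz.2)
end
end

section
/- Let S be a relative Schottky set in a domain Ω ⊆ ℂ, let p₀ ∈ ℂ and r > 0 be such that the open disc B(p₀, 2r) is contained in Ω, and let x, y be points of the closure of S ∩ B(p₀, r). Then there exists a continuous curve l : [0,1] → S ∩ B(p₀, 2r) with l(0) = x, l(1) = y, and length(l) ≤ π·|x − y|. -/
open Set Metric MeasureTheory Filter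
open scoped NNReal ENNReal Topology

noncomputable section

/-- Two points `u`, `v` of a circle are joined by an arc of that circle which is parametrised
with speed at most `π * dist u v` and lies in the disc with diameter `[u, v]`. -/
lemma exists_short_circular_arc (c : ℂ) (ρ : ℝ) (hρ : 0 < ρ) (u v : ℂ)
    (hu : dist u c = ρ) (hv : dist v c = ρ) :
    ∃ g : ℝ → ℂ, g 0 = u ∧ g 1 = v ∧ (∀ t, dist (g t) c = ρ) ∧
      (∀ s t, dist (g s) (g t) ≤ Real.pi * dist u v * |s - t|) ∧
      ∀ t ∈ Icc (0 : ℝ) 1, ((g t - u) * (starRingEnd ℂ) (g t - v)).re ≤ 0 := by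
  have hu' : ‖u - c‖ = ρ := by rw [← dist_eq_norm, hu]
  have hv' : ‖v - c‖ = ρ := by rw [← dist_eq_norm, hv]
  have huc : u - c ≠ 0 := by rw [← norm_pos_iff, hu']; exact hρ
  obtain ⟨δ, hδ₁, hδ₂, hδ⟩ : ∃ δ : ℝ, -Real.pi < δ ∧ δ ≤ Real.pi ∧
      v - c = (u - c) * Complex.exp (Complex.I * δ) := by
    refine ⟨Complex.arg ((v - c) / (u - c)), Complex.neg_pi_lt_arg _, Complex.arg_le_pi _, ?_⟩
    have h := Complex.norm_mul_exp_arg_mul_I ((v - c) / (u - c))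
    rw [norm_div, hu', hv', div_self hρ.ne', Complex.ofReal_one, one_mul] at h
    rw [mul_comm Complex.I, h]
    field_simp
  have hnorm : ∀ x : ℝ, ‖Complex.exp (Complex.I * x)‖ = 1 := fun x => by
    rw [mul_comm]; exact Complex.norm_exp_ofReal_mul_I x
  have hchord : dist u v = ρ * (2 * |Real.sin (δ / 2)|) := by
    have h : v - u = (u - c) * (Complex.exp (Complex.I * δ) - 1) := by linear_combination hδ
    rw [dist_comm, dist_eq_norm, h, norm_mul, hu', Complex.norm_exp_I_mul_ofReal_sub_one,
      Real.norm_eq_abs, abs_mul, abs_two]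
  have hδabs : |δ| ≤ Real.pi := abs_le.2 ⟨hδ₁.le, hδ₂⟩
  have hspeed : ρ * |δ| ≤ Real.pi * dist u v := by
    have hj : 2 / Real.pi * |δ / 2| ≤ |Real.sin (δ / 2)| := by
      apply Real.mul_abs_le_abs_sin
      rw [abs_div, abs_two]; linarith
    rw [abs_div, abs_two] at hj
    have hj' : |δ| ≤ Real.pi * |Real.sin (δ / 2)| := by
      have := mul_le_mul_of_nonneg_left hj Real.pi_pos.le
      calc |δ| = Real.pi * (2 / Real.pi * (|δ| / 2)) := by field_simp
        _ ≤ _ := this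
    rw [hchord]
    have h0 : 0 ≤ Real.pi * |Real.sin (δ / 2)| := by positivity
    nlinarith
  refine ⟨fun t => c + (u - c) * Complex.exp (Complex.I * ((δ * t : ℝ) : ℂ)),
    by simp, ?_, ?_, ?_, ?_⟩
  · simp only [mul_one]; rw [← hδ]; ring
  · intro t
    rw [dist_eq_norm, add_sub_cancel_left, norm_mul, hnorm, hu', mul_one]
  · intro s t
    have h : (c + (u - c) * Complex.exp (Complex.I * ((δ * s : ℝ) : ℂ))) -
        (c + (u - c) * Complex.exp (Complex.I * ((δ * t : ℝ) : ℂ))) =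
        (u - c) * Complex.exp (Complex.I * ((δ * t : ℝ) : ℂ)) *
          (Complex.exp (Complex.I * ((δ * (s - t) : ℝ) : ℂ)) - 1) := by
      have : Complex.exp (Complex.I * ((δ * s : ℝ) : ℂ)) =
          Complex.exp (Complex.I * ((δ * t : ℝ) : ℂ)) *
            Complex.exp (Complex.I * ((δ * (s - t) : ℝ) : ℂ)) := by
        rw [← Complex.exp_add]; congr 1; push_cast; ring
      rw [this]; ring
    rw [dist_eq_norm, h, norm_mul, norm_mul, hnorm, hu', mul_one]
    calc _ ≤ ρ * ‖δ * (s - t)‖ := by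
          gcongr; exact Real.norm_exp_I_mul_ofReal_sub_one_le
      _ = ρ * |δ| * |s - t| := by rw [Real.norm_eq_abs, abs_mul]; ring
      _ ≤ _ := by gcongr
  · intro t ht
    have hcos : 1 - Real.cos (δ * t) - Real.cos (δ * (1 - t)) + Real.cos δ ≤ 0 := by
      have e1 : Real.cos (δ * t) + Real.cos (δ * (1 - t)) =
          2 * Real.cos (δ / 2) * Real.cos (δ * (2 * t - 1) / 2) := by
        rw [Real.cos_add_cos]; congr 2 <;> ring_nf
      have e2 : Real.cos δ = 2 * Real.cos (δ / 2) ^ 2 - 1 := by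
        rw [← Real.cos_two_mul]; ring_nf
      have h0 : 0 ≤ Real.cos (δ / 2) :=
        Real.cos_nonneg_of_mem_Icc ⟨by linarith, by linarith⟩
      have h1 : Real.cos (δ / 2) ≤ Real.cos (δ * (2 * t - 1) / 2) := by
        rw [← Real.cos_abs (δ / 2), ← Real.cos_abs (δ * (2 * t - 1) / 2)]
        apply Real.cos_le_cos_of_nonneg_of_le_pi (abs_nonneg _)
        · rw [abs_div, abs_two]; linarith [Real.pi_pos]
        · rw [abs_div, abs_div, abs_mul]
          have : |2 * t - 1| ≤ 1 := abs_le.2 ⟨by linarith [ht.1], by linarith [ht.2]⟩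
          gcongr
          exact mul_le_of_le_one_right (abs_nonneg _) this
      nlinarith
    have hv2 : v = c + (u - c) * Complex.exp (Complex.I * δ) := by rw [← hδ]; ring
    have key : (c + (u - c) * Complex.exp (Complex.I * ((δ * t : ℝ) : ℂ)) - u) *
        (starRingEnd ℂ) (c + (u - c) * Complex.exp (Complex.I * ((δ * t : ℝ) : ℂ)) - v) =
        ((u - c) * (starRingEnd ℂ) (u - c)) *
          ((Complex.exp (Complex.I * ((δ * t : ℝ) : ℂ)) - 1) *
            (starRingEnd ℂ) (Complex.exp (Complex.I * ((δ * t : ℝ) : ℂ)) -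
              Complex.exp (Complex.I * δ))) := by
      conv_lhs => rw [hv2]
      simp only [map_add, map_sub, map_mul]
      ring
    have hre : ((Complex.exp (Complex.I * ((δ * t : ℝ) : ℂ)) - 1) *
            (starRingEnd ℂ) (Complex.exp (Complex.I * ((δ * t : ℝ) : ℂ)) -
              Complex.exp (Complex.I * δ))).re =
        1 - Real.cos (δ * t) - Real.cos (δ * (1 - t)) + Real.cos δ := by
      have e : δ * (1 - t) = δ - δ * t := by ring
      rw [e, Real.cos_sub, mul_comm Complex.I, mul_comm Complex.I]
      simp only [Complex.mul_re, Complex.sub_re, Complex.sub_im, map_sub, Complex.conj_re,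
        Complex.conj_im, Complex.exp_ofReal_mul_I_re, Complex.exp_ofReal_mul_I_im,
        Complex.one_re, Complex.one_im]
      linear_combination Real.sin_sq_add_cos_sq (δ * t)
    simp only [key]
    rw [Complex.mul_conj, Complex.re_ofReal_mul, hre]
    exact mul_nonpos_of_nonneg_of_nonpos (Complex.normSq_nonneg _) hcos

/-- If `z` lies in the disc whose diameter is a chord of `closedBall p r`, then it lies in
`ball p (2 * r)`. -/
lemma mem_ball_two_mul_of_diameter {p u v z : ℂ} {r : ℝ} (hr : 0 < r)
    (hu : u ∈ closedBall p r) (hv : v ∈ closedBall p r)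
    (hz : ((z - u) * (starRingEnd ℂ) (z - v)).re ≤ 0) : z ∈ ball p (2 * r) := by
  rw [mem_closedBall, dist_eq_norm] at hu hv
  rw [mem_ball, dist_eq_norm]
  have hu2 : ‖u - p‖ ^ 2 ≤ r ^ 2 := by gcongr
  have hv2 : ‖v - p‖ ^ 2 ≤ r ^ 2 := by gcongr
  refine lt_of_pow_lt_pow_left₀ 2 (by positivity) ?_
  rw [← Complex.normSq_eq_norm_sq, Complex.normSq_apply] at *
  simp only [Complex.mul_re, Complex.sub_re, Complex.sub_im, map_sub, Complex.conj_re,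
    Complex.conj_im] at *
  nlinarith [sq_nonneg (z.re - p.re - (u.re - p.re) - (v.re - p.re)),
    sq_nonneg (z.im - p.im - (u.im - p.im) - (v.im - p.im)), sq_pos_of_pos hr]

/-- The parameters at which a segment with end points outside an open disc meets that disc form
an open interval whose end points are mapped to the boundary circle. -/
lemma exists_chord_interval (x y c : ℂ) (ρ : ℝ) (hx : x ∉ ball c ρ) (hy : y ∉ ball c ρ)
    (t₀ : ℝ) (ht₀ : t₀ ∈ Icc (0 : ℝ) 1) (hmem : AffineMap.lineMap x y t₀ ∈ ball c ρ) :
    ∃ a b : ℝ, 0 ≤ a ∧ a < b ∧ b ≤ 1 ∧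
      dist (AffineMap.lineMap x y a) c = ρ ∧ dist (AffineMap.lineMap x y b) c = ρ ∧
      ∀ t : ℝ, AffineMap.lineMap x y t ∈ ball c ρ ↔ t ∈ Ioo a b := by
  set φ : ℝ → ℝ := fun t => dist (AffineMap.lineMap x y t) c with hφ
  have hcont : Continuous φ := (AffineMap.lineMap_continuous).dist continuous_const
  have hconv : ConvexOn ℝ univ φ :=
    (convexOn_univ_dist c).comp_affineMap (AffineMap.lineMap x y : ℝ →ᵃ[ℝ] ℂ)
  have h₀ : φ t₀ < ρ := hmem
  have hφ0 : ρ ≤ φ 0 := by simpa [hφ] using hx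
  have hφ1 : ρ ≤ φ 1 := by simpa [hφ] using hy
  obtain ⟨a, ha, hφa⟩ := intermediate_value_Icc' ht₀.1 hcont.continuousOn ⟨h₀.le, hφ0⟩
  obtain ⟨b, hb, hφb⟩ := intermediate_value_Icc ht₀.2 hcont.continuousOn ⟨h₀.le, hφ1⟩
  have ha' : a < t₀ := lt_of_le_of_ne ha.2 (by rintro rfl; exact h₀.ne hφa)
  have hb' : t₀ < b := lt_of_le_of_ne hb.1 (by rintro rfl; exact h₀.ne hφb)
  have left : ∀ {p q s : ℝ}, p < s → s < q → φ p < φ s → φ s < φ q := fun {p q s} h1 h2 h3 =>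
    hconv.lt_right_of_left_lt (mem_univ p) (mem_univ q)
      (by rw [openSegment_eq_Ioo (h1.trans h2)]; exact ⟨h1, h2⟩) h3
  have right : ∀ {p q s : ℝ}, p < s → s < q → φ q < φ s → φ s < φ p := fun {p q s} h1 h2 h3 =>
    hconv.lt_left_of_right_lt (mem_univ p) (mem_univ q)
      (by rw [openSegment_eq_Ioo (h1.trans h2)]; exact ⟨h1, h2⟩) h3
  refine ⟨a, b, ha.1, ha'.trans hb', hb.2, hφa, hφb, fun t => ?_⟩
  change φ t < ρ ↔ _
  constructor
  · intro ht
    by_contra hcon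
    rcases le_or_gt t a with h | h
    · rcases h.eq_or_lt with rfl | h
      · exact ht.ne hφa
      · have := left h ha' (by rw [hφa]; exact ht)
        linarith
    · have hbt : b ≤ t := not_lt.1 fun h' => hcon ⟨h, h'⟩
      rcases hbt.eq_or_lt with rfl | h
      · exact ht.ne hφb
      · have := right hb' h (by rw [hφb]; exact ht)
        linarith
  · rintro ⟨h1, h2⟩
    by_contra! hcon
    rcases lt_trichotomy t t₀ with h | rfl | h
    · have := right h1 h (h₀.trans_le hcon)
      linarith
    · linarith
    · have := left h h2 (h₀.trans_le hcon)
      linarith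

/-- A Lipschitz path remains Lipschitz, with the larger constant, when it is replaced on pairwise
disjoint intervals by Lipschitz paths with the same end points. -/
lemma exists_lipschitz_replacement {E I : Type*} [PseudoMetricSpace E] (f : ℝ → E) (A : I → Set ℝ)
    (K₀ K : ℝ) (hK : K₀ ≤ K) (hf : ∀ s t, dist (f s) (f t) ≤ K₀ * |s - t|)
    (hA : Pairwise fun i j => Disjoint (A i) (A j))
    (a b : I → ℝ) (g : I → ℝ → E)
    (hint : ∀ i, (∃ t ∈ Icc (0 : ℝ) 1, t ∈ A i) →
      0 ≤ a i ∧ a i < b i ∧ b i ≤ 1 ∧ A i = Ioo (a i) (b i) ∧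
        g i (a i) = f (a i) ∧ g i (b i) = f (b i) ∧
        (∀ j, a i ∉ A j ∧ b i ∉ A j) ∧
        ∀ s t, dist (g i s) (g i t) ≤ K * |s - t|) :
    ∃ l : ℝ → E, (∀ t i, t ∈ A i → l t = g i t) ∧ (∀ t, (∀ i, t ∉ A i) → l t = f t) ∧
      ∀ s ∈ Icc (0 : ℝ) 1, ∀ t ∈ Icc (0 : ℝ) 1, dist (l s) (l t) ≤ K * |s - t| := by
  have hex : ∀ t, ∃ z, (∀ i, t ∈ A i → z = g i t) ∧ ((∀ i, t ∉ A i) → z = f t) := by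
    intro t
    by_cases h : ∃ i, t ∈ A i
    · obtain ⟨i, hi⟩ := h
      refine ⟨g i t, fun j hj => ?_, fun h => absurd hi (h i)⟩
      obtain rfl : i = j := by
        by_contra hij
        exact disjoint_left.1 (hA hij) hi hj
      rfl
    · push Not at h
      exact ⟨f t, fun i hi => absurd hi (h i), fun _ => rfl⟩
  choose l hlg hlf using hex
  refine ⟨l, hlg, hlf, ?_⟩
  have hfK : ∀ s t, s ≤ t → dist (f s) (f t) ≤ K * (t - s) := fun s t hst => by
    have h := hf s t
    rw [abs_sub_comm, abs_of_nonneg (sub_nonneg.2 hst)] at h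
    exact h.trans (mul_le_mul_of_nonneg_right hK (sub_nonneg.2 hst))
  have hfrom : ∀ q t, t ∈ Icc (0 : ℝ) 1 → q ≤ t → (∀ i, q ∉ A i) →
      dist (f q) (l t) ≤ K * (t - q) := by
    intro q t ht hqt hq
    by_cases h : ∃ i, t ∈ A i
    · obtain ⟨i, hi⟩ := h
      obtain ⟨-, -, -, hAi, hga, -, -, hgl⟩ := hint i ⟨t, ht, hi⟩
      have hi' := hAi ▸ hi
      have hqa : q ≤ a i := by
        by_contra! hlt
        exact hq i (hAi ▸ ⟨hlt, hqt.trans_lt hi'.2⟩)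
      have h1 := hfK q (a i) hqa
      have h2 := hgl (a i) t
      rw [hga, ← hlg t i hi, abs_sub_comm, abs_of_nonneg (sub_nonneg.2 hi'.1.le)] at h2
      linarith [dist_triangle (f q) (f (a i)) (l t)]
    · push Not at h
      rw [hlf t h]
      exact hfK q t hqt
  have hmain : ∀ s ∈ Icc (0 : ℝ) 1, ∀ t ∈ Icc (0 : ℝ) 1, s ≤ t →
      dist (l s) (l t) ≤ K * (t - s) := by
    intro s hs t ht hst
    by_cases h : ∃ i, s ∈ A i
    · obtain ⟨i, hi⟩ := h
      obtain ⟨-, -, -, hAi, -, hgb, hab, hgl⟩ := hint i ⟨s, hs, hi⟩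
      have hi' := hAi ▸ hi
      rcases lt_or_ge t (b i) with htb | hbt
      · have hti : t ∈ A i := hAi ▸ ⟨hi'.1.trans_le hst, htb⟩
        rw [hlg s i hi, hlg t i hti]
        have h2 := hgl s t
        rwa [abs_sub_comm, abs_of_nonneg (sub_nonneg.2 hst)] at h2
      · have h1 := hfrom (b i) t ht hbt fun j => (hab j).2
        have h2 := hgl s (b i)
        rw [hgb, ← hlg s i hi, abs_sub_comm, abs_of_nonneg (sub_nonneg.2 hi'.2.le)] at h2
        linarith [dist_triangle (l s) (f (b i)) (l t)]
    · push Not at h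
      rw [hlf s h]
      exact hfrom s t ht hst h
  intro s hs t ht
  rcases le_total s t with h | h
  · rw [abs_sub_comm, abs_of_nonneg (sub_nonneg.2 h)]
    exact hmain s hs t ht h
  · rw [dist_comm, abs_of_nonneg (sub_nonneg.2 h)]
    exact hmain t ht s hs h

/-- Points of the closure of `S ∩ B(p₀,r)` can be joined inside
`S ∩ B(p₀,2r)` by a curve of length at most `π` times their distance, provided
`B(p₀,2r) ⊆ Ω`. -/
theorem schottky_local_quasiconvexity
    (Ω S : Set ℂ) (hS : IsRelativeSchottkySet Ω S)
    (p₀ : ℂ) (r : ℝ) (hr : 0 < r) (hball : ball p₀ (2 * r) ⊆ Ω)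
    (x y : ℂ) (hx : x ∈ closure (S ∩ ball p₀ r)) (hy : y ∈ closure (S ∩ ball p₀ r)) :
    ∃ l : ℝ → ℂ, ContinuousOn l (Icc 0 1) ∧
      MapsTo l (Icc 0 1) (S ∩ ball p₀ (2 * r)) ∧
      l 0 = x ∧ l 1 = y ∧
      eVariationOn l (Icc 0 1) ≤ ENNReal.ofReal (Real.pi * dist x y) := by
  obtain ⟨-, I, c, ρ, ⟨hρ, hcΩ, hdisj⟩, rfl⟩ := hS
  have hends : ∀ z ∈ closure ((Ω \ ⋃ i, ball (c i) (ρ i)) ∩ ball p₀ r),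
      z ∈ closedBall p₀ r ∧ ∀ i, z ∉ ball (c i) (ρ i) := by
    intro z hz
    refine ⟨closure_ball_subset_closedBall (closure_mono inter_subset_right hz), fun i => ?_⟩
    have hsub : (Ω \ ⋃ i, ball (c i) (ρ i)) ∩ ball p₀ r ⊆ (ball (c i) (ρ i))ᶜ :=
      fun w hw hwi => hw.1.2 (mem_iUnion_of_mem i hwi)
    exact closure_minimal hsub isOpen_ball.isClosed_compl hz
  obtain ⟨hxr, hxb⟩ := hends x hx
  obtain ⟨hyr, hyb⟩ := hends y hy
  have hlt : r < 2 * r := by linarith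
  have hseg : ∀ t ∈ Icc (0 : ℝ) 1, AffineMap.lineMap x y t ∈ closedBall p₀ r := fun t ht =>
    (convex_closedBall p₀ r).lineMap_mem hxr hyr ht
  have hsphere : ∀ z i, dist z (c i) = ρ i → z ∈ Ω \ ⋃ i, ball (c i) (ρ i) := by
    intro z i hz
    refine ⟨hcΩ i (mem_closedBall.2 hz.le), fun hmem => ?_⟩
    obtain ⟨j, hj⟩ := mem_iUnion.1 hmem
    by_cases hij : i = j
    · subst hij
      exact (mem_ball.1 hj).ne hz
    · exact disjoint_left.1 (hdisj hij) (mem_closedBall.2 hz.le) (ball_subset_closedBall hj)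
  have hdata : ∀ i, ∃ (a b : ℝ) (g : ℝ → ℂ),
      (∃ t ∈ Icc (0 : ℝ) 1, t ∈ {t : ℝ | AffineMap.lineMap x y t ∈ ball (c i) (ρ i)}) →
      (0 ≤ a ∧ a < b ∧ b ≤ 1 ∧
        {t : ℝ | AffineMap.lineMap x y t ∈ ball (c i) (ρ i)} = Ioo a b ∧
        g a = AffineMap.lineMap x y a ∧ g b = AffineMap.lineMap x y b ∧
        (∀ j, a ∉ {t : ℝ | AffineMap.lineMap x y t ∈ ball (c j) (ρ j)} ∧
          b ∉ {t : ℝ | AffineMap.lineMap x y t ∈ ball (c j) (ρ j)}) ∧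
        ∀ s t, dist (g s) (g t) ≤ Real.pi * dist x y * |s - t|) ∧
      (∀ t, dist (g t) (c i) = ρ i) ∧ ∀ t ∈ Ioo a b, g t ∈ ball p₀ (2 * r) := by
    intro i
    by_cases h : ∃ t ∈ Icc (0 : ℝ) 1,
      t ∈ {t : ℝ | AffineMap.lineMap x y t ∈ ball (c i) (ρ i)}
    swap
    · exact ⟨0, 0, fun _ => 0, fun h' => absurd h' h⟩
    obtain ⟨t₀, ht₀, hmem⟩ := h
    obtain ⟨a, b, h0a, hab, hb1, hda, hdb, hiff⟩ :=
      exists_chord_interval x y (c i) (ρ i) (hxb i) (hyb i) t₀ ht₀ hmem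
    obtain ⟨G, hG0, hG1, hGs, hGl, hGd⟩ :=
      exists_short_circular_arc (c i) (ρ i) (hρ i) _ _ hda hdb
    have hba : 0 < b - a := sub_pos.2 hab
    have hnot : ∀ s : ℝ, dist (AffineMap.lineMap x y s) (c i) = ρ i →
        ∀ j, s ∉ {t : ℝ | AffineMap.lineMap x y t ∈ ball (c j) (ρ j)} :=
      fun s hs j hj => (hsphere _ i hs).2 (mem_iUnion_of_mem j hj)
    refine ⟨a, b, fun t => G ((t - a) / (b - a)), fun _ => ⟨⟨h0a, hab, hb1, Set.ext hiff,
      by simpa using hG0, by simpa [div_self hba.ne'] using hG1,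
      fun j => ⟨hnot a hda j, hnot b hdb j⟩, fun s t => ?_⟩, fun t => hGs _, fun t ht => ?_⟩⟩
    · refine (hGl _ _).trans_eq ?_
      rw [dist_lineMap_lineMap, ← sub_div, abs_div, abs_of_pos hba, sub_sub_sub_cancel_right,
        dist_comm a b, Real.dist_eq, abs_of_pos hba]
      field_simp
    · refine mem_ball_two_mul_of_diameter hr (hseg a ⟨h0a, by linarith⟩)
        (hseg b ⟨by linarith, hb1⟩) (hGd _ ⟨?_, ?_⟩)
      · exact div_nonneg (by linarith [ht.1]) hba.le
      · rw [div_le_one hba]; linarith [ht.2]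
  choose a b g hg using hdata
  obtain ⟨l, hlg, hlf, hlip⟩ := exists_lipschitz_replacement
    (fun t : ℝ => AffineMap.lineMap x y t)
    (fun i => {t : ℝ | AffineMap.lineMap x y t ∈ ball (c i) (ρ i)})
    (dist x y) (Real.pi * dist x y)
    (le_mul_of_one_le_left dist_nonneg (by linarith [Real.pi_gt_three]))
    (fun s t => by rw [dist_lineMap_lineMap, Real.dist_eq, mul_comm])
    (fun i j hij => disjoint_left.2 fun t hti htj => disjoint_left.1 (hdisj hij)
      (ball_subset_closedBall hti) (ball_subset_closedBall htj))
    a b g (fun i hi => (hg i hi).1)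
  have hL : LipschitzOnWith (Real.toNNReal (Real.pi * dist x y)) l (Icc 0 1) :=
    LipschitzOnWith.of_dist_le_mul fun s hs t ht => by
      rw [Real.coe_toNNReal _ (by positivity), Real.dist_eq]
      exact hlip s hs t ht
  refine ⟨l, hL.continuousOn, fun t ht => ?_, ?_, ?_, ?_⟩
  · by_cases h : ∃ i, AffineMap.lineMap x y t ∈ ball (c i) (ρ i)
    · obtain ⟨i, hi⟩ := h
      obtain ⟨⟨-, -, -, hAi, -⟩, hs, hball'⟩ := hg i ⟨t, ht, hi⟩
      rw [hlg t i hi]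
      exact ⟨hsphere _ i (hs t), hball' t (hAi ▸ hi)⟩
    · push Not at h
      rw [hlf t h]
      have hmem := closedBall_subset_ball hlt (hseg t ht)
      exact ⟨⟨hball hmem, fun hU => by
        obtain ⟨i, hi⟩ := mem_iUnion.1 hU
        exact h i hi⟩, hmem⟩
  · rw [hlf 0 (fun i => by simpa using hxb i)]
    simp
  · rw [hlf 1 (fun i => by simpa using hyb i)]
    simp
  · have hcomp := hL.comp_eVariationOn_le (g := id) (s := Icc (0 : ℝ) 1) (mapsTo_id _)
    have hid : eVariationOn (id : ℝ → ℝ) (Icc 0 1) ≤ 1 := by simp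
    calc eVariationOn l (Icc 0 1) ≤ _ := hcomp
      _ ≤ ENNReal.ofReal (Real.pi * dist x y) * 1 := by
        gcongr
        exact le_rfl
      _ = _ := mul_one _
end
end

section
/- Let S = Ω \ ⋃_{i∈I} B_i be a relative Schottky set in a domain Ω ⊆ ℂ, and let C ⊆ S be the image of a continuous injective map from the unit circle {z ∈ ℂ : |z| = 1} into S. Then S \ C is a connected topological space if and only if C is a peripheral circle of S, i.e., C = ∂B_i for some i ∈ I. -/
open Set Metric MeasureTheory Filter
open scoped NNReal ENNReal Topology

noncomputable section

/-- Two continuous functions on a preconnected set with equal exponentials differ by a constant. -/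
theorem IsPreconnected.sub_eq_sub_of_exp_eq {X : Type*} [TopologicalSpace X] {s : Set X}
    (hs : IsPreconnected s) {f g : X → ℂ} (hf : ContinuousOn f s) (hg : ContinuousOn g s)
    (h : ∀ x ∈ s, Complex.exp (f x) = Complex.exp (g x)) {x y : X} (hx : x ∈ s) (hy : y ∈ s) :
    f x - g x = f y - g y := by
  have hdisc : IsDiscrete
      ((AddSubgroup.zmultiples (2 * Real.pi * Complex.I : ℂ) : AddSubgroup ℂ) : Set ℂ) :=
    ⟨NormedSpace.discreteTopology_zmultiples _⟩
  refine hs.constant_of_mapsTo (f := fun x ↦ f x - g x) hdisc (hf.sub hg) (fun z hz ↦ ?_) hx hy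
  obtain ⟨n, hn⟩ := Complex.exp_eq_exp_iff_exists_int.1 (h z hz)
  exact AddSubgroup.mem_zmultiples_iff.2 ⟨n, by simp [hn]⟩

/-- The quotient `(z - α 1) / (z - α 0)` has a continuous logarithm off the path `α`. -/
theorem exists_continuousOn_log_compl_range (α : C(unitInterval, ℂ)) :
    ∃ L : ℂ → ℂ, ContinuousOn L (range α)ᶜ ∧
      ∀ z ∉ range α, (z - α 0) * Complex.exp (L z) = z - α 1 := by
  classical
  have hne (z : ((range α)ᶜ : Set ℂ)) (t : unitInterval) : (z : ℂ) - α t ≠ 0 :=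
    fun h ↦ z.2 ⟨t, (sub_eq_zero.1 h).symm⟩
  let H : C(unitInterval × ((range α)ᶜ : Set ℂ), {z : ℂ // z ≠ 0}) :=
    ⟨fun p ↦ ⟨((p.2 : ℂ) - α p.1) / ((p.2 : ℂ) - α 0), div_ne_zero (hne _ _) (hne _ _)⟩,
      Continuous.subtype_mk (Continuous.div (by fun_prop) (by fun_prop) fun p ↦ hne _ _) _⟩
  have H0 : ∀ z, H (0, z) = ⟨Complex.exp (ContinuousMap.const _ (0 : ℂ) z),
      Complex.exp_ne_zero _⟩ := fun z ↦ Subtype.ext <| by simp [H, div_self (hne z 0)]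
  let F := Complex.isCoveringMap_exp.liftHomotopy H (.const _ 0) H0
  have hF : ∀ p, Complex.exp (F p) = H p := fun p ↦
    congrArg Subtype.val (congrFun (Complex.isCoveringMap_exp.liftHomotopy_lifts H _ H0) p)
  refine ⟨fun z ↦ if h : z ∈ (range α)ᶜ then F (1, ⟨z, h⟩) else 0, ?_, fun z hz ↦ ?_⟩
  · rw [continuousOn_iff_continuous_domRestrict]
    have : Continuous fun z : ((range α)ᶜ : Set ℂ) ↦ F (1, z) := by fun_prop
    convert! this using 1
    ext z
    simp [Set.domRestrict, -mem_compl_iff]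
  · have hz' : z ∈ (range α)ᶜ := hz
    simp only [dif_pos hz', hF]
    exact mul_div_cancel₀ _ (hne ⟨z, hz'⟩ 0)

/-- The quotient `(z - a) / (z - b)` has no continuous logarithm on the plane punctured at `a`
and `b`. -/
theorem not_exists_continuousOn_log_compl_pair {a b : ℂ} (hab : a ≠ b) :
    ¬ ∃ L : ℂ → ℂ, ContinuousOn L {a, b}ᶜ ∧
      ∀ z ∈ ({a, b}ᶜ : Set ℂ), (z - b) * Complex.exp (L z) = z - a := by
  rintro ⟨L, hL, hexp⟩
  have hd : a - b ≠ 0 := sub_ne_zero.2 hab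
  let w : ℝ → ℂ := fun θ ↦ Complex.exp (θ * Complex.I) / 2
  have hw : Continuous w := by fun_prop
  have hwn (θ) : ‖w θ‖ = 1 / 2 := by simp [w, Complex.norm_exp_ofReal_mul_I]
  have hslit (θ) : 1 + w θ ∈ Complex.slitPlane :=
    Complex.mem_slitPlane_of_norm_lt_one (by rw [hwn]; norm_num)
  let z : ℝ → ℂ := fun θ ↦ a + (a - b) * w θ
  have hz : Continuous z := by fun_prop
  have hzb (θ) : z θ - b = (a - b) * (1 + w θ) := by simp only [z]; ring
  have hmem (θ) : z θ ∈ ({a, b}ᶜ : Set ℂ) := by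
    simp only [mem_compl_iff, mem_insert_iff, mem_singleton_iff, not_or, z]
    refine ⟨fun h ↦ ?_, fun h ↦ ?_⟩
    · exact mul_ne_zero hd (norm_ne_zero_iff.1 (by rw [hwn]; norm_num)) (add_eq_left.1 h)
    · exact mul_ne_zero hd (Complex.slitPlane_ne_zero (hslit θ)) (by rw [← hzb, sub_eq_zero]; exact h)
  let f : ℝ → ℂ := fun θ ↦ L (z θ) + Complex.log (1 + w θ)
  have hf : Continuous f :=
    (hL.comp_continuous hz hmem).add (Continuous.clog (by fun_prop) hslit)
  have hfe (θ) : Complex.exp (f θ) = w θ := by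
    have h := hexp _ (hmem θ)
    rw [hzb] at h
    simp only [f, Complex.exp_add, Complex.exp_log (Complex.slitPlane_ne_zero (hslit θ))]
    apply mul_left_cancel₀ hd
    rw [show (a - b) * w θ = z θ - a by simp [z], ← h]
    ring
  have key := isPreconnected_univ.sub_eq_sub_of_exp_eq (f := f)
    (g := fun θ : ℝ ↦ θ * Complex.I - Complex.log 2) hf.continuousOn (by fun_prop)
    (fun θ _ ↦ by simp [hfe, Complex.exp_sub, Complex.exp_log, w]) (mem_univ 0)
    (mem_univ (2 * Real.pi))
  have hw2 : w (2 * Real.pi) = w 0 := by simp [w, Complex.exp_two_pi_mul_I]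
  have hf2 : f (2 * Real.pi) = f 0 := by simp only [f, z, hw2]
  rw [hf2] at key
  have : (2 * Real.pi * Complex.I : ℂ) = 0 := by
    push_cast at key
    linear_combination key
  exact Complex.two_pi_I_ne_zero this

/-- The union of two arcs with common endpoints `a ≠ b`, disjoint otherwise, separates the
plane. -/
theorem not_isPreconnected_compl_range_union_range {α β : C(unitInterval, ℂ)}
    (h0 : α 0 = β 0) (h1 : α 1 = β 1) (hne : α 0 ≠ α 1)
    (hinter : range α ∩ range β ⊆ {α 1, α 0}) :
    ¬ IsPreconnected (range α ∪ range β)ᶜ := by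
  classical
  intro hpc
  obtain ⟨L₁, hL₁, he₁⟩ := exists_continuousOn_log_compl_range α
  obtain ⟨L₂, hL₂, he₂⟩ := exists_continuousOn_log_compl_range β
  have hA : IsClosed (range α) := (isCompact_range α.continuous).isClosed
  have hB : IsClosed (range β) := (isCompact_range β.continuous).isClosed
  have hsub₁ : (range α ∪ range β)ᶜ ⊆ (range α)ᶜ := compl_subset_compl.2 subset_union_left
  have hsub₂ : (range α ∪ range β)ᶜ ⊆ (range β)ᶜ := compl_subset_compl.2 subset_union_right
  have hC : (range α ∪ range β) ≠ univ :=
    ((isCompact_range α.continuous).union (isCompact_range β.continuous)).ne_univ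
  obtain ⟨z₀, hz₀⟩ := nonempty_compl.2 hC
  have hk : ∀ z ∈ (range α ∪ range β)ᶜ, L₁ z = L₂ z + (L₁ z₀ - L₂ z₀) := fun z hz ↦ by
    rw [← hpc.sub_eq_sub_of_exp_eq (hL₁.mono hsub₁) (hL₂.mono hsub₂) (fun y hy ↦ ?_) hz hz₀]
    · ring
    · have hy0 : y - α 0 ≠ 0 := fun h ↦ hy (Or.inl ⟨0, (sub_eq_zero.1 h).symm⟩)
      apply mul_left_cancel₀ hy0
      rw [he₁ y (hsub₁ hy), h0, he₂ y (hsub₂ hy), h1]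
  refine not_exists_continuousOn_log_compl_pair hne.symm
    ⟨(range α)ᶜ.piecewise L₁ fun z ↦ L₂ z + (L₁ z₀ - L₂ z₀), fun z hz ↦ ?_, fun z hz ↦ ?_⟩
  · apply ContinuousAt.continuousWithinAt
    by_cases hzA : z ∈ range α
    · have hzB : z ∉ range β := fun h ↦ hz (hinter ⟨hzA, h⟩)
      have hev : ∀ᶠ y in 𝓝 z, y ∈ (range β)ᶜ := hB.isOpen_compl.mem_nhds hzB
      refine ((hL₂.continuousAt hev).add (continuousAt_const (y := L₁ z₀ - L₂ z₀))).congr ?_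
      filter_upwards [hev] with y hy
      by_cases hyA : y ∈ range α
      · rw [Set.piecewise_eq_of_notMem _ _ _ (not_not.2 hyA)]
        rfl
      · rw [Set.piecewise_eq_of_mem _ _ _ hyA]
        exact (hk y (by simp only [compl_union]; exact ⟨hyA, hy⟩)).symm
    · have hev : (range α)ᶜ ∈ 𝓝 z := hA.isOpen_compl.mem_nhds hzA
      refine (hL₁.continuousAt hev).congr ?_
      filter_upwards [hev] with y hy
      rw [Set.piecewise_eq_of_mem _ _ _ hy]
  · by_cases hzA : z ∈ range α
    · have hzB : z ∉ range β := fun h ↦ hz (hinter ⟨hzA, h⟩)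
      rw [Set.piecewise_eq_of_notMem _ _ _ (not_not.2 hzA)]
      have : Complex.exp (L₁ z₀ - L₂ z₀) = 1 := by
        have hy0 : z₀ - α 0 ≠ 0 := fun h ↦ hz₀ (Or.inl ⟨0, (sub_eq_zero.1 h).symm⟩)
        rw [Complex.exp_sub, div_eq_one_iff_eq (Complex.exp_ne_zero _)]
        apply mul_left_cancel₀ hy0
        rw [he₁ _ (hsub₁ hz₀), h0, he₂ _ (hsub₂ hz₀), h1]
      rw [Complex.exp_add, this, mul_one, h0, he₂ z hzB, h1]
    · rw [Set.piecewise_eq_of_mem _ _ _ hzA, he₁ z hzA]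

/-- A Jordan curve separates the plane. -/
theorem not_isPreconnected_compl_image_sphere {γ : ℂ → ℂ}
    (hγc : ContinuousOn γ (sphere (0 : ℂ) 1)) (hγi : InjOn γ (sphere (0 : ℂ) 1)) :
    ¬ IsPreconnected (γ '' sphere (0 : ℂ) 1)ᶜ := by
  let e : ℝ → ℂ := fun t ↦ Complex.exp ((Real.pi * t : ℝ) * Complex.I)
  have he : Continuous e := by fun_prop
  have hes (t) : e t ∈ sphere (0 : ℂ) 1 := by
    simp only [e, mem_sphere_zero_iff_norm, Complex.norm_exp_ofReal_mul_I]
  have him (t) : (e t).im = Real.sin (Real.pi * t) := Complex.exp_ofReal_mul_I_im _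
  let α : C(unitInterval, ℂ) := ⟨fun t ↦ γ (e t), hγc.comp_continuous (by fun_prop) fun t ↦ hes t⟩
  let β : C(unitInterval, ℂ) :=
    ⟨fun t ↦ γ (e (-t)), hγc.comp_continuous (by fun_prop) fun t ↦ hes _⟩
  have e0 : e 0 = 1 := by simp [e]
  have e1 : e 1 = -1 := by simp [e]
  have e1' : e (-1) = -1 := by simp [e, Complex.exp_neg]
  have hpos (t : unitInterval) : 0 ≤ Real.sin (Real.pi * t) :=
    Real.sin_nonneg_of_nonneg_of_le_pi (mul_nonneg Real.pi_pos.le t.2.1)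
      (mul_le_of_le_one_right Real.pi_pos.le t.2.2)
  have hunion : γ '' sphere (0 : ℂ) 1 = range α ∪ range β := by
    ext x
    constructor
    · rintro ⟨z, hz, rfl⟩
      have hz1 : ‖z‖ = 1 := by simpa using hz
      have hza : e (z.arg / Real.pi) = z := by
        simp only [e]
        rw [mul_div_cancel₀ _ Real.pi_ne_zero]
        simpa [hz1] using Complex.norm_mul_exp_arg_mul_I z
      rcases le_total 0 z.arg with h | h
      · exact Or.inl ⟨⟨z.arg / Real.pi, div_nonneg h Real.pi_pos.le,
          div_le_one_of_le₀ (Complex.arg_le_pi z) Real.pi_pos.le⟩, by simp [α, hza]⟩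
      · exact Or.inr ⟨⟨-(z.arg / Real.pi), neg_nonneg.2 (div_nonpos_of_nonpos_of_nonneg h
          Real.pi_pos.le), by
            rw [neg_le, le_div_iff₀ Real.pi_pos]
            linarith [Complex.neg_pi_lt_arg z]⟩, by simp [β, hza]⟩
    · rintro (⟨t, rfl⟩ | ⟨t, rfl⟩)
      exacts [⟨_, hes _, rfl⟩, ⟨_, hes _, rfl⟩]
  rw [hunion]
  refine not_isPreconnected_compl_range_union_range (by simp [α, β]) (by simp [α, β, e1, e1'])
    (fun h ↦ ?_) ?_
  · have := hγi (hes _) (hes _) h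
    norm_num [e0, e1] at this
  · rintro _ ⟨⟨t, rfl⟩, ⟨s, hs⟩⟩
    have hts : e (-s) = e t := hγi (hes _) (hes _) hs
    have h := congrArg Complex.im hts
    rw [him, him, mul_neg, Real.sin_neg] at h
    have h0 : (e t).im = 0 := by rw [him]; linarith [hpos s, hpos t]
    have hn : (e t).re ^ 2 = 1 := by
      have := Complex.sq_norm_sub_sq_im (e t)
      rw [mem_sphere_zero_iff_norm.1 (hes t), h0] at this
      linarith
    rcases sq_eq_sq_iff_eq_or_eq_neg.1 (hn.trans (one_pow 2).symm) with h | h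
    · exact Or.inr (congrArg γ ((Complex.ext h h0 : e t = 1).trans e0.symm))
    · exact Or.inl (congrArg γ
        ((Complex.ext h (by simp [h0]) : e t = -1).trans e1.symm))

/-- A round circle contained in a Jordan curve is the whole curve. -/
theorem image_sphere_subset_of_sphere_subset {γ : ℂ → ℂ}
    (hγc : ContinuousOn γ (sphere (0 : ℂ) 1)) (hγi : InjOn γ (sphere (0 : ℂ) 1))
    {c : ℂ} {r : ℝ} (hr : 0 < r) (h : sphere c r ⊆ γ '' sphere (0 : ℂ) 1) :
    γ '' sphere (0 : ℂ) 1 ⊆ sphere c r := by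
  rintro _ ⟨w, hw, rfl⟩
  by_contra hwc
  have hw0 : w ≠ 0 := ne_zero_of_mem_unit_sphere (⟨w, hw⟩ : sphere (0 : ℂ) 1)
  have hw1 : ‖w‖ = 1 := by simpa using hw
  have hemb : Topology.IsClosedEmbedding (fun z : sphere (0 : ℂ) 1 ↦ γ z) :=
    hγc.domRestrict.isClosedEmbedding (injOn_iff_injective.1 hγi)
  let φ := hemb.isEmbedding.toHomeomorph
  have hmem (x : sphere c r) : (x : ℂ) ∈ range fun z : sphere (0 : ℂ) 1 ↦ γ z := by
    obtain ⟨z, hz, hzx⟩ := h x.2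
    exact ⟨⟨z, hz⟩, hzx⟩
  let δ : sphere c r → sphere (0 : ℂ) 1 := fun x ↦ φ.symm ⟨x, hmem x⟩
  have hδ : Continuous δ := φ.symm.continuous.comp (by fun_prop)
  have hγδ (x) : γ (δ x) = x := congrArg Subtype.val (φ.apply_symm_apply ⟨x, hmem x⟩)
  have hδn (x) : ‖-(δ x : ℂ) / w‖ = 1 := by simp [hw1]
  have hslit (x) : -(δ x : ℂ) / w ∈ Complex.slitPlane := by
    rw [Complex.mem_slitPlane_iff_arg]
    refine ⟨fun harg ↦ hwc ?_, norm_ne_zero_iff.1 (by rw [hδn]; exact one_ne_zero)⟩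
    have := Complex.norm_mul_exp_arg_mul_I (-(δ x : ℂ) / w)
    rw [harg, hδn, Complex.exp_pi_mul_I, Complex.ofReal_one, one_mul, eq_div_iff hw0] at this
    rw [show w = δ x by linear_combination -this, hγδ]
    exact x.2
  let g : sphere c r → ℝ := fun x ↦ (-(δ x : ℂ) / w).arg
  have hg : Continuous g := continuous_iff_continuousAt.2 fun x ↦
    (Complex.continuousAt_arg (hslit x)).comp (f := fun x ↦ -(δ x : ℂ) / w) (by fun_prop)
  have hginj : Function.Injective g := fun x y hxy ↦ by
    have := Complex.ext_norm_arg ((hδn x).trans (hδn y).symm) hxy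
    rw [div_left_inj' hw0, neg_inj] at this
    exact Subtype.ext (by rw [← hγδ, this, hγδ])
  let σ : sphere c r → sphere c r := fun x ↦ ⟨2 * c - x, by
    rw [mem_sphere_iff_norm, show 2 * c - x - c = -((x : ℂ) - c) by ring, norm_neg]
    exact mem_sphere_iff_norm.1 x.2⟩
  have hσ : Continuous σ := by fun_prop
  have hσσ (x) : σ (σ x) = x := Subtype.ext (by simp [σ])
  have hconn : IsConnected (sphere c r) := isConnected_sphere (by simp) c hr.le
  have : ConnectedSpace (sphere c r) := isConnected_iff_connectedSpace.1 hconn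
  obtain ⟨x₀⟩ := (inferInstance : Nonempty (sphere c r))
  obtain ⟨x, hx⟩ : ∃ x, g x = g (σ x) := by
    rcases le_total (g x₀) (g (σ x₀)) with h | h
    · exact intermediate_value_univ₂ (a := x₀) (b := σ x₀) hg (hg.comp hσ) h
        (by simpa [hσσ] using h)
    · exact intermediate_value_univ₂ (a := σ x₀) (b := x₀) hg (hg.comp hσ)
        (by simpa [hσσ] using h) h
  have hxc : (x : ℂ) = 2 * c - x := congrArg Subtype.val (hginj hx)
  have hxc' : (x : ℂ) = c := by linear_combination hxc / 2
  have := x.2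
  rw [hxc', mem_sphere_iff_norm, sub_self, norm_zero] at this
  exact hr.ne this

/-- The peripheral circles of a relative Schottky set belong to it. -/
theorem IsSchottkyFamily.sphere_subset {I : Type*} {Ω : Set ℂ} {c : I → ℂ} {r : I → ℝ}
    (hfam : IsSchottkyFamily Ω c r) (j : I) :
    sphere (c j) (r j) ⊆ Ω \ ⋃ i, ball (c i) (r i) := by
  refine fun x hx ↦ ⟨hfam.2.1 j (sphere_subset_closedBall hx), fun hx' ↦ ?_⟩
  obtain ⟨k, hk⟩ := mem_iUnion.1 hx'
  by_cases hkj : k = j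
  · subst hkj
    exact (mem_ball.1 hk).ne (mem_sphere.1 hx)
  · exact disjoint_left.1 (hfam.2.2 hkj) (ball_subset_closedBall hk)
      (sphere_subset_closedBall hx)

/-- Removing disjoint open discs from a preconnected open set leaves a preconnected set. -/
theorem isPreconnected_diff_iUnion_ball {I : Type*} {Ω : Set ℂ} {c : I → ℂ} {r : I → ℝ}
    (hΩo : IsOpen Ω) (hΩ : IsPreconnected Ω) (hfam : IsSchottkyFamily Ω c r) :
    IsPreconnected (Ω \ ⋃ i, ball (c i) (r i)) := by
  obtain ⟨hr, hsub, hdisj⟩ := hfam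
  set S := Ω \ ⋃ i, ball (c i) (r i) with hS
  have hsphere := IsSchottkyFamily.sphere_subset ⟨hr, hsub, hdisj⟩
  have hconn (j) : IsConnected (sphere (c j) (r j)) := isConnected_sphere (by simp) _ (hr j).le
  -- `fill u` is the part of `S` in `u` together with the discs whose boundary circle lies in `u`.
  let fill : Set ℂ → Set ℂ := fun u ↦
    (S ∩ u) ∪ ⋃ j, ⋃ (_ : sphere (c j) (r j) ⊆ u), ball (c j) (r j)
  have hfill {u v : Set ℂ} (hu : IsOpen u) (hv : IsOpen v) (huv : S ⊆ u ∪ v)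
      (hd : S ∩ (u ∩ v) = ∅) : IsOpen (fill u) := by
    rw [Metric.isOpen_iff]
    rintro x (⟨hxS, hxu⟩ | hx)
    · obtain ⟨ε, hε, hball⟩ := Metric.isOpen_iff.1 (hu.inter hΩo) x ⟨hxu, hxS.1⟩
      refine ⟨ε, hε, fun y hy ↦ ?_⟩
      by_cases hyS : y ∈ S
      · exact Or.inl ⟨hyS, (hball hy).1⟩
      obtain ⟨j, hj⟩ : ∃ j, y ∈ ball (c j) (r j) := by
        by_contra hne
        exact hyS ⟨(hball hy).2, fun h ↦ hne (mem_iUnion.1 h)⟩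
      have hxj : r j ≤ dist x (c j) := by
        by_contra hlt
        exact hxS.2 (mem_iUnion.2 ⟨j, not_le.1 hlt⟩)
      obtain ⟨p, hp, hpj⟩ := (convex_ball x ε).isPreconnected.intermediate_value hy
        (mem_ball_self hε) (f := fun p ↦ dist p (c j)) (by fun_prop)
        ⟨(mem_ball.1 hj).le, hxj⟩
      have hju : sphere (c j) (r j) ⊆ u := by
        refine (isPreconnected_iff_subset_of_disjoint.1 (hconn j).isPreconnected u v hu hv
          ((hsphere j).trans huv)
          (subset_empty_iff.1 (hd ▸ inter_subset_inter_left _ (hsphere j)))).resolve_right ?_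
        intro hjv
        exact (hd ▸ ⟨hsphere j hpj, (hball hp).1, hjv hpj⟩ : p ∈ (∅ : Set ℂ))
      exact Or.inr (mem_iUnion₂.2 ⟨j, hju, hj⟩)
    · obtain ⟨j, hj, hxj⟩ := mem_iUnion₂.1 hx
      obtain ⟨ε, hε, hball⟩ := Metric.isOpen_iff.1 isOpen_ball x hxj
      exact ⟨ε, hε, fun y hy ↦ Or.inr (mem_iUnion₂.2 ⟨j, hj, hball hy⟩)⟩
  rintro u v hu hv huv ⟨a, haS, hau⟩ ⟨b, hbS, hbv⟩
  by_contra hne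
  have hd := not_nonempty_iff_eq_empty.1 hne
  obtain ⟨x, hxΩ, hxu, hxv⟩ := hΩ (fill u) (fill v) (hfill hu hv huv hd)
    (hfill hv hu (by rwa [union_comm]) (by rwa [inter_comm v])) (fun x hx ↦ by
      by_cases hxS : x ∈ S
      · exact (huv hxS).imp (fun h ↦ Or.inl ⟨hxS, h⟩) fun h ↦ Or.inl ⟨hxS, h⟩
      obtain ⟨j, hj⟩ : ∃ j, x ∈ ball (c j) (r j) := by
        by_contra hne
        exact hxS ⟨hx, fun h ↦ hne (mem_iUnion.1 h)⟩
      exact (isPreconnected_iff_subset_of_disjoint.1 (hconn j).isPreconnected u v hu hv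
        ((hsphere j).trans huv)
        (subset_empty_iff.1 (hd ▸ inter_subset_inter_left _ (hsphere j)))).imp
        (fun h ↦ Or.inr (mem_iUnion₂.2 ⟨j, h, hj⟩)) fun h ↦ Or.inr (mem_iUnion₂.2 ⟨j, h, hj⟩))
    ⟨a, haS.1, Or.inl ⟨haS, hau⟩⟩ ⟨b, hbS.1, Or.inl ⟨hbS, hbv⟩⟩
  rcases hxu with ⟨hxS, hxu⟩ | hxu
  · rcases hxv with ⟨-, hxv⟩ | hxv
    · exact hne ⟨x, hxS, hxu, hxv⟩
    · obtain ⟨j, -, hxj⟩ := mem_iUnion₂.1 hxv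
      exact hxS.2 (mem_iUnion.2 ⟨j, hxj⟩)
  · obtain ⟨j, hju, hxj⟩ := mem_iUnion₂.1 hxu
    rcases hxv with ⟨hxS, -⟩ | hxv
    · exact hxS.2 (mem_iUnion.2 ⟨j, hxj⟩)
    · obtain ⟨k, hkv, hxk⟩ := mem_iUnion₂.1 hxv
      obtain rfl : j = k := by
        by_contra hjk
        exact disjoint_left.1 (hdisj hjk) (ball_subset_closedBall hxj) (ball_subset_closedBall hxk)
      obtain ⟨p, hp⟩ := (hconn j).nonempty
      exact hne ⟨p, hsphere j hp, hju hp, hkv hp⟩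

/-- A round open annulus is preconnected. -/
theorem isPreconnected_ball_diff_closedBall (c : ℂ) {r R : ℝ} (hr : 0 ≤ r) :
    IsPreconnected (ball c R \ closedBall c r) := by
  have h : ball c R \ closedBall c r =
      (fun p : ℝ × ℂ ↦ c + p.1 * p.2) '' (Ioo r R ×ˢ sphere (0 : ℂ) 1) := by
    ext z
    simp only [Set.mem_sdiff, mem_ball_iff_norm, mem_closedBall_iff_norm, not_le, mem_image, mem_prod,
      mem_Ioo, mem_sphere_zero_iff_norm, Prod.exists]
    constructor
    · rintro ⟨h1, h2⟩
      have hz : (‖z - c‖ : ℂ) ≠ 0 := by exact_mod_cast (hr.trans_lt h2).ne'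
      refine ⟨‖z - c‖, (z - c) / ‖z - c‖, ⟨⟨h2, h1⟩, ?_⟩, by rw [mul_div_cancel₀ _ hz]; ring⟩
      rw [norm_div, Complex.norm_real, norm_norm, div_self (hr.trans_lt h2).ne']
    · rintro ⟨t, w, ⟨⟨h1, h2⟩, hw⟩, rfl⟩
      simp [hw, abs_of_pos (hr.trans_lt h1), h1, h2]
  rw [h]
  exact (isPreconnected_Ioo.prod (isConnected_sphere (by simp) _ zero_le_one).isPreconnected).image
    _ (by fun_prop)

/-- Removing a closed disc from a domain leaves a domain. -/
theorem IsPlaneDomain.diff_closedBall {Ω : Set ℂ} (hΩ : IsPlaneDomain Ω) {c : ℂ} {r : ℝ}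
    (hr : 0 < r) (h : closedBall c r ⊆ Ω) : IsPlaneDomain (Ω \ closedBall c r) := by
  obtain ⟨δ, hδ, hδΩ⟩ := (isCompact_closedBall c r).exists_thickening_subset_open hΩ.1 h
  rw [thickening_closedBall hδ hr.le] at hδΩ
  have hne : (ball c (δ + r) \ closedBall c r).Nonempty := by
    refine ⟨c + ((δ / 2 + r : ℝ) : ℂ), ?_, ?_⟩
    · rw [mem_ball_iff_norm, add_sub_cancel_left, Complex.norm_real, Real.norm_eq_abs,
        abs_of_pos (by positivity)]
      linarith
    · rw [mem_closedBall_iff_norm, add_sub_cancel_left, Complex.norm_real, Real.norm_eq_abs,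
        abs_of_pos (by positivity)]
      linarith
  have hsub : ball c (δ + r) \ closedBall c r ⊆ Ω \ closedBall c r := sdiff_subset_sdiff_left hδΩ
  have hopen : IsOpen (Ω \ closedBall c r) := hΩ.1.sdiff isClosed_closedBall
  have hann := isPreconnected_ball_diff_closedBall c (R := δ + r) hr.le
  refine ⟨hopen, hne.mono hsub, ?_⟩
  have key : ∀ u v : Set ℂ, IsOpen u → IsOpen v →
      (Ω \ closedBall c r) ⊆ u ∪ v → ((Ω \ closedBall c r) ∩ v).Nonempty →
      (Ω \ closedBall c r) ∩ (u ∩ v) = ∅ → ball c (δ + r) \ closedBall c r ⊆ u → False := by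
    intro u v hu hv huv ⟨b, hb, hbv⟩ hd hu'
    obtain ⟨p, hp⟩ := hne
    obtain ⟨x, -, hx | hx, hxv⟩ := hΩ.2.isPreconnected
      (((Ω \ closedBall c r) ∩ u) ∪ ball c (δ + r)) ((Ω \ closedBall c r) ∩ v)
      ((hopen.inter hu).union isOpen_ball) (hopen.inter hv) (fun x hx ↦ by
        by_cases hxc : x ∈ closedBall c r
        · exact Or.inl (Or.inr (closedBall_subset_ball (by linarith) hxc))
        · exact (huv ⟨hx, hxc⟩).imp (fun h ↦ Or.inl ⟨⟨hx, hxc⟩, h⟩) fun h ↦ ⟨⟨hx, hxc⟩, h⟩)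
      ⟨p, hδΩ hp.1, Or.inr hp.1⟩ ⟨b, hb.1, hb, hbv⟩
    · exact (hd ▸ ⟨hx.1, hx.2, hxv.2⟩ : x ∈ (∅ : Set ℂ))
    · exact (hd ▸ ⟨hxv.1, hu' ⟨hx, hxv.1.2⟩, hxv.2⟩ : x ∈ (∅ : Set ℂ))
  intro u v hu hv huv hnu hnv
  by_contra hcon
  have hd := not_nonempty_iff_eq_empty.1 hcon
  rcases isPreconnected_iff_subset_of_disjoint.1 hann u v hu hv (hsub.trans huv)
    (subset_empty_iff.1 (hd ▸ inter_subset_inter_left _ hsub)) with h | h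
  · exact key u v hu hv huv hnv hd h
  · exact key v u hv hu (by rwa [union_comm]) hnu (by rwa [inter_comm v]) h

/-- A relative Schottky set is connected. -/
theorem IsPlaneDomain.isConnected_diff_iUnion_ball {I : Type*} {Ω : Set ℂ} {c : I → ℂ} {r : I → ℝ}
    (hΩ : IsPlaneDomain Ω) (hfam : IsSchottkyFamily Ω c r) :
    IsConnected (Ω \ ⋃ i, ball (c i) (r i)) := by
  refine ⟨?_, isPreconnected_diff_iUnion_ball hΩ.1 hΩ.2.isPreconnected hfam⟩
  obtain ⟨x, hx⟩ := hΩ.2.nonempty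
  by_cases h : x ∈ ⋃ i, ball (c i) (r i)
  · obtain ⟨j, -⟩ := mem_iUnion.1 h
    exact (isConnected_sphere (by simp) (c j) (hfam.1 j).le).nonempty.mono (hfam.sphere_subset j)
  · exact ⟨x, hx, h⟩

/-- Every neighborhood of a Jordan curve is separated by it: the complement of the curve splits
into two disjoint open sets meeting the neighborhood. -/
theorem exists_isOpen_separation_of_image_sphere {γ : ℂ → ℂ}
    (hγc : ContinuousOn γ (sphere (0 : ℂ) 1)) (hγi : InjOn γ (sphere (0 : ℂ) 1)) {Ω : Set ℂ}
    (hΩ : IsOpen Ω) (hγΩ : γ '' sphere (0 : ℂ) 1 ⊆ Ω) :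
    ∃ u v : Set ℂ, IsOpen u ∧ IsOpen v ∧ Disjoint u v ∧ u ∪ v = (γ '' sphere (0 : ℂ) 1)ᶜ ∧
      (Ω ∩ u).Nonempty ∧ (Ω ∩ v).Nonempty := by
  set C := γ '' sphere (0 : ℂ) 1
  have hC : IsClosed C := ((isCompact_sphere _ _).image_of_continuousOn hγc).isClosed
  obtain ⟨u, v, hu, hv, huv, hnu, hnv, hd⟩ : ∃ u v : Set ℂ, IsOpen u ∧ IsOpen v ∧ Cᶜ ⊆ u ∪ v ∧
      (Cᶜ ∩ u).Nonempty ∧ (Cᶜ ∩ v).Nonempty ∧ ¬ (Cᶜ ∩ (u ∩ v)).Nonempty := by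
    simpa [IsPreconnected] using not_isPreconnected_compl_image_sphere hγc hγi
  have hd' : Disjoint (Cᶜ ∩ u) (Cᶜ ∩ v) :=
    disjoint_left.2 fun x hx hx' ↦ hd ⟨x, hx.1, hx.2, hx'.2⟩
  have hun : (Cᶜ ∩ u) ∪ (Cᶜ ∩ v) = Cᶜ := by
    rw [← inter_union_distrib_left, inter_eq_left.2 huv]
  have key : ∀ s t : Set ℂ, IsOpen s → IsOpen t → Disjoint s t → s ∪ t = Cᶜ → s.Nonempty →
      t.Nonempty → (Ω ∩ s).Nonempty := by
    intro s t hs ht hst hstC hsn ⟨y, hy⟩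
    by_contra hne
    have hcompl : sᶜ = t ∪ Ω := by
      ext x
      refine ⟨fun hx ↦ ?_, fun hx hxs ↦ hx.elim (disjoint_left.1 hst hxs) fun h ↦ hne ⟨x, h, hxs⟩⟩
      by_cases hxC : x ∈ C
      · exact Or.inr (hγΩ hxC)
      · exact Or.inl ((hstC.ge hxC).resolve_left hx)
    have hclopen : IsClopen s := ⟨⟨hcompl ▸ ht.union hΩ⟩, hs⟩
    have := hclopen.eq_univ hsn
    exact disjoint_left.1 hst (this ▸ mem_univ y) hy
  have hu' := hC.isOpen_compl.inter hu
  have hv' := hC.isOpen_compl.inter hv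
  exact ⟨_, _, hu', hv', hd', hun, key _ _ hu' hv' hd' hun hnu hnv,
    key _ _ hv' hu' hd'.symm (by rwa [union_comm]) hnv hnu⟩

/-- If one side of a separation of the plane by a Jordan curve misses the relative Schottky set,
then the curve is a peripheral circle. -/
theorem IsSchottkyFamily.exists_eq_sphere_of_disjoint {I : Type*} {Ω : Set ℂ} {c : I → ℂ}
    {r : I → ℝ} (hfam : IsSchottkyFamily Ω c r) {γ : ℂ → ℂ}
    (hγc : ContinuousOn γ (sphere (0 : ℂ) 1)) (hγi : InjOn γ (sphere (0 : ℂ) 1))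
    (hγS : γ '' sphere (0 : ℂ) 1 ⊆ Ω \ ⋃ i, ball (c i) (r i)) {u v : Set ℂ}
    (hu : IsOpen u) (hv : IsOpen v) (huv : Disjoint u v)
    (hun : u ∪ v = (γ '' sphere (0 : ℂ) 1)ᶜ) (hne : (Ω ∩ u).Nonempty)
    (hS : Disjoint (Ω \ ⋃ i, ball (c i) (r i)) u) :
    ∃ i, γ '' sphere (0 : ℂ) 1 = sphere (c i) (r i) := by
  obtain ⟨x, hxΩ, hxu⟩ := hne
  obtain ⟨i, hi⟩ : ∃ i, x ∈ ball (c i) (r i) := by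
    by_contra h
    exact disjoint_left.1 hS ⟨hxΩ, fun h' ↦ h (mem_iUnion.1 h')⟩ hxu
  have hball : ball (c i) (r i) ⊆ u :=
    (convex_ball _ _).isPreconnected.subset_left_of_subset_union hu hv huv
      (fun y hy ↦ hun.ge fun hyC ↦ (hγS hyC).2 (mem_iUnion.2 ⟨i, hy⟩)) ⟨x, hi, hxu⟩
  have hsphere : sphere (c i) (r i) ⊆ γ '' sphere (0 : ℂ) 1 := by
    intro y hy
    by_contra hyC
    rcases hun.ge hyC with h | h
    · exact disjoint_left.1 hS (hfam.sphere_subset i hy) h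
    · have hycl : y ∈ closure (ball (c i) (r i)) := by
        rw [closure_ball _ (hfam.1 i).ne']
        exact sphere_subset_closedBall hy
      obtain ⟨z, hzv, hzb⟩ := mem_closure_iff.1 hycl v hv h
      exact disjoint_left.1 huv (hball hzb) hzv
  exact ⟨i, (image_sphere_subset_of_sphere_subset hγc hγi (hfam.1 i) hsphere).antisymm hsphere⟩

/-- Removing a peripheral circle from a relative Schottky set leaves a connected set. -/
theorem IsPlaneDomain.isConnected_diff_sphere {I : Type*} {Ω : Set ℂ} {c : I → ℂ} {r : I → ℝ}
    (hΩ : IsPlaneDomain Ω) (hfam : IsSchottkyFamily Ω c r) (i : I) :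
    IsConnected ((Ω \ ⋃ j, ball (c j) (r j)) \ sphere (c i) (r i)) := by
  have hfam' : IsSchottkyFamily (Ω \ closedBall (c i) (r i)) (fun j : {j // j ≠ i} ↦ c j)
      (fun j ↦ r j) :=
    ⟨fun j ↦ hfam.1 j, fun j ↦ subset_sdiff.2 ⟨hfam.2.1 j, hfam.2.2 j.2⟩,
      fun j k hjk ↦ hfam.2.2 (Subtype.coe_ne_coe.2 hjk)⟩
  convert! (hΩ.diff_closedBall (hfam.1 i) (hfam.2.1 i)).isConnected_diff_iUnion_ball hfam' using 1
  ext x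
  simp only [Set.mem_sdiff, mem_iUnion, not_exists, ← ball_union_sphere, mem_union, not_or,
    Subtype.forall]
  constructor
  · rintro ⟨⟨h1, h2⟩, h3⟩
    exact ⟨⟨h1, h2 i, h3⟩, fun j _ ↦ h2 j⟩
  · rintro ⟨⟨h1, h2, h3⟩, h4⟩
    refine ⟨⟨h1, fun j ↦ ?_⟩, h3⟩
    by_cases hj : j = i
    · exact hj ▸ h2
    · exact h4 j hj

/-- For a topological circle `C` embedded in a relative Schottky set `S`,
the set `S \ C` is connected if and only if `C` is a peripheral circle of `S`. -/
theorem schottky_peripheral_circle_characterization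
    (Ω : Set ℂ) {I : Type} (c : I → ℂ) (r : I → ℝ)
    (hΩ : IsPlaneDomain Ω) (hfam : IsSchottkyFamily Ω c r)
    (S : Set ℂ) (hSdef : S = Ω \ ⋃ i, ball (c i) (r i))
    (C : Set ℂ) (hCS : C ⊆ S)
    (γ : ℂ → ℂ) (hγc : ContinuousOn γ (sphere (0 : ℂ) 1))
    (hγi : InjOn γ (sphere (0 : ℂ) 1)) (hγC : γ '' sphere (0 : ℂ) 1 = C) :
    IsConnected (S \ C) ↔ ∃ i, C = sphere (c i) (r i) := by
  subst hSdef hγC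
  constructor
  · intro hconn
    obtain ⟨u, v, hu, hv, hd, hun, hnu, hnv⟩ :=
      exists_isOpen_separation_of_image_sphere hγc hγi hΩ.1 (hCS.trans sdiff_subset)
    have hdisj : ∀ {s t : Set ℂ}, Disjoint s t → s ∪ t = (γ '' sphere (0 : ℂ) 1)ᶜ →
        (Ω \ ⋃ i, ball (c i) (r i)) \ γ '' sphere (0 : ℂ) 1 ⊆ t →
        Disjoint (Ω \ ⋃ i, ball (c i) (r i)) s := fun hst hun h ↦
      disjoint_left.2 fun x hx hxs ↦
        disjoint_left.1 hst hxs (h ⟨hx, hun.le (Or.inl hxs)⟩)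
    rcases isPreconnected_iff_subset_of_disjoint.1 hconn.isPreconnected u v hu hv
      (fun x hx ↦ hun.ge hx.2) (by rw [hd.inter_eq, inter_empty]) with h | h
    · have hun' : v ∪ u = (γ '' sphere (0 : ℂ) 1)ᶜ := by rwa [union_comm]
      exact hfam.exists_eq_sphere_of_disjoint hγc hγi hCS hv hu hd.symm hun' hnv
        (hdisj hd.symm hun' h)
    · exact hfam.exists_eq_sphere_of_disjoint hγc hγi hCS hu hv hd hun hnu (hdisj hd hun h)
  · rintro ⟨i, hi⟩
    rw [hi]
    exact hΩ.isConnected_diff_sphere hfam i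
end
end

section
/- For every λ ≥ 1 there exists a constant C ≥ 0, depending only on λ, such that for every finite collection B₁, …, B_n of pairwise disjoint open discs in the plane ℝ² and all nonnegative real numbers a₁, …, a_n, one has ∫_{ℝ²} ( Σ_{i=1}^n a_i·χ_{λB_i} )² dA ≤ C · Σ_{i=1}^n a_i² · area(B_i), where χ_E denotes the characteristic function of a set E and λB_i is the open disc with the same center as B_i and λ times its radius, and dA is 2-dimensional Lebesgue measure. -/
open Set Metric MeasureTheory Filter
open scoped NNReal ENNReal Topology

noncomputable section

section MaximalEstimate

variable {E : Type*} [NormedAddCommGroup E] [NormedSpace ℝ E] [MeasurableSpace E] [BorelSpace E]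
  [FiniteDimensional ℝ E] {ι : Type*}

/-- Dilating a ball by a positive factor multiplies its Haar measure by the appropriate power. -/
lemma addHaar_ball_dilate (μ : Measure E) [μ.IsAddHaarMeasure] (x : E) {c : ℝ} (hc : 0 < c)
    (r : ℝ) :
    μ (ball x (c * r)) = ENNReal.ofReal (c ^ Module.finrank ℝ E) * μ (ball x r) := by
  rw [Measure.addHaar_ball_mul_of_pos μ x hc, Measure.addHaar_ball_center μ x r]

/-- Finite Vitali covering lemma, in measure form. -/
lemma exists_disjoint_balls_measure_biUnion_le [Nontrivial E] (μ : Measure E) [μ.IsAddHaarMeasure]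
    (T : Finset ι) (x : ι → E) (r : ι → ℝ) :
    ∃ u ⊆ T, (u : Set ι).PairwiseDisjoint (fun i => ball (x i) (r i)) ∧
      μ (⋃ i ∈ T, ball (x i) (r i)) ≤
        ENNReal.ofReal (5 ^ Module.finrank ℝ E) * ∑ i ∈ u, μ (ball (x i) (r i)) := by
  classical
  obtain ⟨R, hR⟩ := (T.image r).bddAbove
  obtain ⟨u, huT, hdisj, hcov⟩ := Vitali.exists_disjoint_subfamily_covering_enlargement_closedBall
    (T : Set ι) x r R (fun a ha => hR (by simpa using ⟨a, ha, rfl⟩)) 5 (by norm_num)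
  lift u to Finset ι using T.finite_toSet.subset huT
  refine ⟨u, by exact_mod_cast huT, hdisj.mono fun i => ball_subset_closedBall, ?_⟩
  have hsub : (⋃ i ∈ T, ball (x i) (r i)) ⊆ ⋃ i ∈ u, closedBall (x i) (5 * r i) := by
    intro y hy
    simp only [mem_iUnion, exists_prop] at hy ⊢
    obtain ⟨i, hi, hy⟩ := hy
    obtain ⟨j, hj, hij⟩ := hcov i hi
    exact ⟨j, hj, hij (ball_subset_closedBall hy)⟩
  refine (measure_mono hsub).trans ((measure_biUnion_finset_le _ _).trans ?_)
  rw [Finset.mul_sum]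
  refine Finset.sum_le_sum fun i _ => ?_
  rw [Measure.addHaar_closedBall_eq_addHaar_ball, addHaar_ball_dilate μ _ (by norm_num)]

/-- If the average of `F` over `s` exceeds `t`, then `t * μ s` is controlled by the integral over
`s` of the part of `F` exceeding `t / 2`. -/
lemma mul_measure_le_of_lt_setLAverage {α : Type*} [MeasurableSpace α] {μ : Measure α} {s : Set α}
    (hs : MeasurableSet s) (hμs : μ s ≠ ∞) {F : α → ℝ≥0∞} (hF : Measurable F) {t : ℝ≥0∞}
    (ht : t < ⨍⁻ y in s, F y ∂μ) :
    t * μ s ≤ 2 * ∫⁻ y in s, {y | t < 2 * F y}.indicator F y ∂μ := by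
  have ht' : t ≠ ∞ := ht.ne_top
  have h1 : t * μ s ≤ ∫⁻ y in s, F y ∂μ := by
    rw [← measure_mul_setLAverage F hμs, mul_comm]
    gcongr
  have hpt : ∀ y ∈ s, 2 * F y ≤ 2 * {y | t < 2 * F y}.indicator F y + t := by
    intro y _
    by_cases hy : t < 2 * F y
    · simp [indicator, hy]
    · exact (not_lt.1 hy).trans le_add_self
  have hset : MeasurableSet {y | t < 2 * F y} := measurableSet_lt measurable_const (hF.const_mul 2)
  have h2 : 2 * ∫⁻ y in s, F y ∂μ
      ≤ 2 * ∫⁻ y in s, {y | t < 2 * F y}.indicator F y ∂μ + t * μ s := by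
    rw [← lintegral_const_mul _ hF, ← lintegral_const_mul _ (hF.indicator hset),
      ← setLIntegral_const, ← lintegral_add_right _ measurable_const]
    exact setLIntegral_mono' hs hpt
  have h3 : t * μ s + t * μ s
      ≤ 2 * ∫⁻ y in s, {y | t < 2 * F y}.indicator F y ∂μ + t * μ s := by
    rw [← two_mul]
    exact (mul_le_mul_right h1 2).trans h2
  exact (ENNReal.add_le_add_iff_right (ENNReal.mul_ne_top ht' hμs)).1 h3

/-- Weak-type estimate for averages over dilates of finitely many disjoint balls. -/
lemma mul_sum_measure_ball_le_of_lt_setLAverage [Nontrivial E] (μ : Measure E)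
    [μ.IsAddHaarMeasure] {lam : ℝ} (hlam : 1 ≤ lam) (T : Finset ι) (x : ι → E) (r : ι → ℝ)
    (hr : ∀ i, 0 < r i) (hdisj : Pairwise fun i j => Disjoint (ball (x i) (r i)) (ball (x j) (r j)))
    {F : E → ℝ≥0∞} (hF : Measurable F) {t : ℝ≥0∞}
    (ht : ∀ i ∈ T, t < ⨍⁻ y in ball (x i) (lam * r i), F y ∂μ) :
    t * ∑ i ∈ T, μ (ball (x i) (r i)) ≤
      ENNReal.ofReal (5 ^ Module.finrank ℝ E) *
        (2 * ∫⁻ y, {y | t < 2 * F y}.indicator F y ∂μ) := by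
  obtain ⟨u, huT, hu, hcov⟩ :=
    exists_disjoint_balls_measure_biUnion_le μ T x (fun i => lam * r i)
  have h1 : ∑ i ∈ T, μ (ball (x i) (r i)) ≤ μ (⋃ i ∈ T, ball (x i) (lam * r i)) := by
    rw [← measure_biUnion_finset (fun i _ j _ hij => hdisj hij) fun i _ => measurableSet_ball]
    refine measure_mono (iUnion₂_mono fun i _ => ball_subset_ball ?_)
    exact le_mul_of_one_le_left (hr i).le hlam
  calc t * ∑ i ∈ T, μ (ball (x i) (r i))
      ≤ t * (ENNReal.ofReal (5 ^ Module.finrank ℝ E) *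
          ∑ i ∈ u, μ (ball (x i) (lam * r i))) := by gcongr; exact h1.trans hcov
    _ = ENNReal.ofReal (5 ^ Module.finrank ℝ E) *
          ∑ i ∈ u, t * μ (ball (x i) (lam * r i)) := by rw [← Finset.mul_sum, mul_left_comm]
    _ ≤ ENNReal.ofReal (5 ^ Module.finrank ℝ E) * ∑ i ∈ u,
          2 * ∫⁻ y in ball (x i) (lam * r i), {y | t < 2 * F y}.indicator F y ∂μ := by
        refine mul_le_mul_right (Finset.sum_le_sum fun i hi => ?_) _
        exact mul_measure_le_of_lt_setLAverage measurableSet_ball measure_ball_lt_top.ne hF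
          (ht i (huT hi))
    _ ≤ _ := by
        rw [← Finset.mul_sum, ← lintegral_biUnion_finset hu fun i _ => measurableSet_ball]
        gcongr
        exact Measure.restrict_le_self

/-- Layer-cake formula for finite weighted sums of squares. -/
lemma sum_mul_ofReal_sq_eq_lintegral [Fintype ι] (w : ι → ℝ≥0∞) (m : ι → ℝ) (hm : ∀ i, 0 ≤ m i) :
    ∑ i, w i * ENNReal.ofReal (m i ^ 2) =
      2 * ∫⁻ t in Ioi (0 : ℝ), ENNReal.ofReal t * ∑ i with t < m i, w i := by
  let _ : MeasurableSpace ι := ⊤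
  have h := lintegral_rpow_eq_lintegral_meas_lt_mul (∑ i, w i • Measure.dirac i) (f := m)
    (Eventually.of_forall hm) measurable_from_top.aemeasurable (p := 2) two_pos
  rw [lintegral_finsetSum_measure] at h
  simp only [lintegral_smul_measure, lintegral_dirac, smul_eq_mul, Real.rpow_two,
    ENNReal.ofReal_ofNat] at h
  rw [h]
  congr 1
  refine lintegral_congr fun t => ?_
  rw [mul_comm]
  norm_num [Measure.dirac_apply, indicator, Finset.sum_filter]

/-- Integrating a constant over the levels below its double gives at most twice its square. -/
lemma lintegral_mul_indicator_ofReal_lt_le (b : ℝ≥0∞) :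
    ∫⁻ t in Ioi (0 : ℝ), {t : ℝ | ENNReal.ofReal t < 2 * b}.indicator (fun _ => b) t
      ≤ 2 * b ^ 2 := by
  rcases eq_or_ne b ∞ with rfl | hb
  · simp
  have hb' : 2 * b ≠ ∞ := ENNReal.mul_ne_top (by simp) hb
  rw [lintegral_indicator (measurableSet_lt ENNReal.measurable_ofReal measurable_const),
    setLIntegral_const, Measure.restrict_apply
      (measurableSet_lt ENNReal.measurable_ofReal measurable_const)]
  have hsub : {t : ℝ | ENNReal.ofReal t < 2 * b} ∩ Ioi 0 ⊆ Ioo 0 (2 * b).toReal :=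
    fun t ht => ⟨ht.2, (ENNReal.ofReal_lt_iff_lt_toReal (le_of_lt ht.2) hb').1 ht.1⟩
  calc b * volume ({t : ℝ | ENNReal.ofReal t < 2 * b} ∩ Ioi 0)
      ≤ b * volume (Ioo 0 (2 * b).toReal) := by gcongr
    _ = 2 * b ^ 2 := by
      rw [Real.volume_Ioo, sub_zero, ENNReal.ofReal_toReal hb']
      ring

/-- Strong-type `L²` estimate for averages over dilates of finitely many disjoint balls. -/
lemma sum_measure_ball_mul_setLAverage_sq_le [Nontrivial E] [Fintype ι] (μ : Measure E)
    [μ.IsAddHaarMeasure] {lam : ℝ} (hlam : 1 ≤ lam) (x : ι → E) (r : ι → ℝ)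
    (hr : ∀ i, 0 < r i) (hdisj : Pairwise fun i j => Disjoint (ball (x i) (r i)) (ball (x j) (r j)))
    {F : E → ℝ≥0∞} (hF : Measurable F)
    (hfin : ∀ i, ⨍⁻ y in ball (x i) (lam * r i), F y ∂μ ≠ ∞) :
    ∑ i, μ (ball (x i) (r i)) * (⨍⁻ y in ball (x i) (lam * r i), F y ∂μ) ^ 2 ≤
      8 * ENNReal.ofReal (5 ^ Module.finrank ℝ E) * ∫⁻ y, F y ^ 2 ∂μ := by
  set K := ENNReal.ofReal (5 ^ Module.finrank ℝ E)
  set m : ι → ℝ := fun i => (⨍⁻ y in ball (x i) (lam * r i), F y ∂μ).toReal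
  have hsq : ∀ i, (⨍⁻ y in ball (x i) (lam * r i), F y ∂μ) ^ 2 = ENNReal.ofReal (m i ^ 2) :=
    fun i => by
      rw [ENNReal.ofReal_pow ENNReal.toReal_nonneg, ENNReal.ofReal_toReal (hfin i)]
  simp_rw [hsq]
  rw [sum_mul_ofReal_sq_eq_lintegral _ m fun i => ENNReal.toReal_nonneg]
  have hmeas : Measurable (Function.uncurry fun (t : ℝ) (y : E) =>
      {y | ENNReal.ofReal t < 2 * F y}.indicator F y) := by
    have : MeasurableSet {p : ℝ × E | ENNReal.ofReal p.1 < 2 * F p.2} :=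
      measurableSet_lt (by fun_prop) (by fun_prop)
    exact (hF.comp measurable_snd).indicator this
  calc 2 * ∫⁻ t in Ioi (0 : ℝ), ENNReal.ofReal t * ∑ i with t < m i, μ (ball (x i) (r i))
      ≤ 2 * ∫⁻ t in Ioi (0 : ℝ),
          K * (2 * ∫⁻ y, {y | ENNReal.ofReal t < 2 * F y}.indicator F y ∂μ) := by
        refine mul_le_mul_right (setLIntegral_mono' measurableSet_Ioi fun t ht => ?_) 2
        refine mul_sum_measure_ball_le_of_lt_setLAverage μ hlam _ x r hr hdisj hF fun i hi => ?_
        exact (ENNReal.ofReal_lt_iff_lt_toReal (le_of_lt ht) (hfin i)).2 (Finset.mem_filter.1 hi).2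
    _ = 4 * K * ∫⁻ t in Ioi (0 : ℝ),
          ∫⁻ y, {y | ENNReal.ofReal t < 2 * F y}.indicator F y ∂μ := by
        rw [lintegral_const_mul' _ _ ENNReal.ofReal_ne_top, lintegral_const_mul' _ _ (by simp)]
        ring
    _ = 4 * K * ∫⁻ y, (∫⁻ t in Ioi (0 : ℝ),
          {t : ℝ | ENNReal.ofReal t < 2 * F y}.indicator (fun _ => F y) t) ∂μ := by
        rw [lintegral_lintegral_swap hmeas.aemeasurable]
        rfl
    _ ≤ 4 * K * ∫⁻ y, 2 * F y ^ 2 ∂μ := by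
        gcongr with y
        exact lintegral_mul_indicator_ofReal_lt_le (F y)
    _ = 8 * K * ∫⁻ y, F y ^ 2 ∂μ := by
        rw [lintegral_const_mul' _ _ (by simp)]
        ring

end MaximalEstimate

/-- Weighted arithmetic-geometric mean inequality in the form used to absorb a term. -/
lemma ofReal_sq_mul_mul_le {lam a : ℝ} (ha : 0 ≤ a) {m : ℝ≥0∞} (hm : m ≠ ∞) :
    ENNReal.ofReal (lam ^ 2) * ENNReal.ofReal a * m ≤
      ENNReal.ofReal (100 * lam ^ 4) * ENNReal.ofReal (a ^ 2) + ENNReal.ofReal (1 / 400) * m ^ 2 := by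
  lift m to ℝ≥0 using hm
  rw [← ENNReal.ofReal_coe_nnreal, ← ENNReal.ofReal_pow (by positivity),
    ← ENNReal.ofReal_mul (by positivity), ← ENNReal.ofReal_mul (by positivity),
    ← ENNReal.ofReal_mul (by positivity), ← ENNReal.ofReal_mul (by positivity),
    ← ENNReal.ofReal_add (by positivity) (by positivity)]
  refine ENNReal.ofReal_le_ofReal ?_
  nlinarith [sq_nonneg (10 * lam ^ 2 * a - m / 20)]

/-- Absorbing half of a finite quantity into the left-hand side. -/
lemma le_two_mul_of_le_add_half {I S : ℝ≥0∞} (hI : I ≠ ∞)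
    (h : I ≤ S + ENNReal.ofReal (1 / 2) * I) : I ≤ 2 * S := by
  have h2 : (2 : ℝ≥0∞) * ENNReal.ofReal (1 / 2) = 1 := by
    rw [← ENNReal.ofReal_ofNat, ← ENNReal.ofReal_mul (by norm_num)]
    norm_num
  have : I + I ≤ 2 * S + I := by
    calc I + I = 2 * I := (two_mul I).symm
      _ ≤ 2 * (S + ENNReal.ofReal (1 / 2) * I) := by gcongr
      _ = 2 * S + I := by rw [mul_add, ← mul_assoc, h2, one_mul]
  exact (ENNReal.add_le_add_iff_right hI).1 this

/-- Bojarski's lemma: For every `λ ≥ 1` there is `C ≥ 0` such that for all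
finite families of pairwise disjoint open discs `B i` in the plane and nonnegative
coefficients `a i`,
`∫ (Σ aᵢ χ_{λBᵢ})² ≤ C Σ aᵢ² area(Bᵢ)`. -/
theorem dilated_discs_L2_estimate (lam : ℝ) (hlam : 1 ≤ lam) :
    ∃ C : ℝ, 0 ≤ C ∧
      ∀ (n : ℕ) (z : Fin n → EuclideanSpace ℝ (Fin 2)) (ρ : Fin n → ℝ) (a : Fin n → ℝ),
        (∀ i, 0 < ρ i) → (∀ i, 0 ≤ a i) →
        (Pairwise fun i j => Disjoint (ball (z i) (ρ i)) (ball (z j) (ρ j))) →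
        ∫⁻ x, ENNReal.ofReal
            ((∑ i, a i * (ball (z i) (lam * ρ i)).indicator (fun _ => (1 : ℝ)) x) ^ 2)
            ∂volume
          ≤ ENNReal.ofReal C *
            ∑ i, ENNReal.ofReal ((a i) ^ 2) * volume (ball (z i) (ρ i)) := by
  refine ⟨2 * (100 * lam ^ 4), by positivity, fun n z ρ a hρ ha hdisj => ?_⟩
  set F : EuclideanSpace ℝ (Fin 2) → ℝ≥0∞ := fun x =>
    ∑ i, (ball (z i) (lam * ρ i)).indicator (fun _ => ENNReal.ofReal (a i)) x with hFdef
  have hF : Measurable F :=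
    Finset.measurable_sum _ fun i _ => measurable_const.indicator measurableSet_ball
  have hsq : ∀ x, ENNReal.ofReal
      ((∑ i, a i * (ball (z i) (lam * ρ i)).indicator (fun _ => (1 : ℝ)) x) ^ 2) = F x ^ 2 := by
    intro x
    have hnn : ∀ i, 0 ≤ a i * (ball (z i) (lam * ρ i)).indicator (fun _ => (1 : ℝ)) x :=
      fun i => mul_nonneg (ha i) (indicator_nonneg (fun _ _ => zero_le_one) x)
    rw [ENNReal.ofReal_pow (Finset.sum_nonneg fun i _ => hnn i),
      ENNReal.ofReal_sum_of_nonneg fun i _ => hnn i]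
    congr 1
    refine Finset.sum_congr rfl fun i _ => ?_
    by_cases hx : x ∈ ball (z i) (lam * ρ i) <;> simp [hx]
  simp_rw [hsq]
  have hF_le : ∀ x, F x ≤ ∑ i, ENNReal.ofReal (a i) := fun x =>
    Finset.sum_le_sum fun i _ => indicator_le_self _ _ x
  have hA : ∑ i, ENNReal.ofReal (a i) ≠ ∞ := by simp
  set m : Fin n → ℝ≥0∞ := fun i => ⨍⁻ y in ball (z i) (lam * ρ i), F y ∂volume with hm
  have hmF : ∀ i, volume (ball (z i) (lam * ρ i)) * m i = ∫⁻ y in ball (z i) (lam * ρ i), F y :=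
    fun i => measure_mul_setLAverage F measure_ball_lt_top.ne
  have hint : ∀ i, ∫⁻ y in ball (z i) (lam * ρ i), F y ≠ ∞ := fun i =>
    ((lintegral_mono hF_le).trans_lt (by
      rw [setLIntegral_const]
      exact ENNReal.mul_lt_top hA.lt_top measure_ball_lt_top)).ne
  have hpos : ∀ i, 0 < lam * ρ i := fun i => mul_pos (by linarith) (hρ i)
  have hmfin : ∀ i, m i ≠ ∞ := fun i => by
    rw [hm]
    simp only [setLAverage_eq]
    exact ENNReal.div_ne_top (hint i) (measure_ball_pos _ _ (hpos i)).ne'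
  have hmul : ∀ x, F x ^ 2 =
      ∑ i, ENNReal.ofReal (a i) * (ball (z i) (lam * ρ i)).indicator F x := by
    intro x
    rw [sq]
    nth_rw 1 [hFdef]
    rw [Finset.sum_mul]
    refine Finset.sum_congr rfl fun i _ => ?_
    by_cases hx : x ∈ ball (z i) (lam * ρ i) <;> simp [hx]
  have hI : ∫⁻ x, F x ^ 2 = ∑ i, ENNReal.ofReal (a i) * ∫⁻ y in ball (z i) (lam * ρ i), F y := by
    simp_rw [hmul]
    rw [lintegral_finsetSum _ fun i _ => (hF.indicator measurableSet_ball).const_mul _]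
    refine Finset.sum_congr rfl fun i _ => ?_
    rw [lintegral_const_mul _ (hF.indicator measurableSet_ball),
      lintegral_indicator measurableSet_ball]
  have hIfin : ∫⁻ x, F x ^ 2 ≠ ∞ := by
    rw [hI]
    exact ENNReal.sum_ne_top.2 fun i _ => ENNReal.mul_ne_top ENNReal.ofReal_ne_top (hint i)
  have hmax := sum_measure_ball_mul_setLAverage_sq_le volume hlam z ρ hρ hdisj hF hmfin
  rw [ENNReal.ofReal_mul zero_le_two, ENNReal.ofReal_ofNat, mul_assoc]
  refine le_two_mul_of_le_add_half hIfin ?_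
  calc ∫⁻ x, F x ^ 2
      = ∑ i, volume (ball (z i) (ρ i)) *
          (ENNReal.ofReal (lam ^ 2) * ENNReal.ofReal (a i) * m i) := by
        rw [hI]
        refine Finset.sum_congr rfl fun i _ => ?_
        rw [← hmF, addHaar_ball_dilate volume _ (by linarith), finrank_euclideanSpace_fin]
        ring
    _ ≤ ∑ i, volume (ball (z i) (ρ i)) * (ENNReal.ofReal (100 * lam ^ 4) *
          ENNReal.ofReal (a i ^ 2) + ENNReal.ofReal (1 / 400) * m i ^ 2) := by
        gcongr with i
        exact ofReal_sq_mul_mul_le (ha i) (hmfin i)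
    _ = ENNReal.ofReal (100 * lam ^ 4) *
          ∑ i, ENNReal.ofReal (a i ^ 2) * volume (ball (z i) (ρ i)) +
        ENNReal.ofReal (1 / 400) * ∑ i, volume (ball (z i) (ρ i)) * m i ^ 2 := by
        rw [Finset.mul_sum, Finset.mul_sum, ← Finset.sum_add_distrib]
        refine Finset.sum_congr rfl fun i _ => ?_
        ring
    _ ≤ ENNReal.ofReal (100 * lam ^ 4) *
          ∑ i, ENNReal.ofReal (a i ^ 2) * volume (ball (z i) (ρ i)) +
        ENNReal.ofReal (1 / 400) *
          (8 * ENNReal.ofReal (5 ^ Module.finrank ℝ (EuclideanSpace ℝ (Fin 2))) *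
            ∫⁻ x, F x ^ 2) := by gcongr
    _ = _ := by
        rw [← mul_assoc (ENNReal.ofReal (1 / 400)), finrank_euclideanSpace_fin,
          ← ENNReal.ofReal_ofNat 8, ← ENNReal.ofReal_mul (by norm_num),
          ← ENNReal.ofReal_mul (by norm_num)]
        norm_num
end
end
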